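/- arXiv:2003.01027 — 6 statements merged into one kernel-verified Lean document; each statement's English description precedes it below -/
import Mathlib

section
/- Let β ∈ (0,1). A positive random variable with Mittag-Leffler density has infinite mean: ∫_0^∞ t · f_β(t) dt = ∞, where f_β(t) = t^{β-1} E_{β,β}(-t^β). -/
open MeasureTheory Set Filter

/-- The two-parameter Mittag-Leffler function `E_{γ,δ}(z) = ∑ zⁿ / Γ(nγ + δ)`. -/
noncomputable def ML2 (γ δ z : ℝ) : ℝ := ∑' n : ℕ, z ^ n / Real.Gamma (n * γ + δ)

/-- The one-parameter Mittag-Leffler function `E_β(z) = E_{β,1}(z)`. -/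
noncomputable def ML (β z : ℝ) : ℝ := ML2 β 1 z

/-- The Mittag-Leffler density `f_β(t) = t^{β-1} E_{β,β}(-t^β)`. -/
noncomputable def fML (β t : ℝ) : ℝ := t ^ (β - 1) * ML2 β β (-(t ^ β))

/-- The spectral kernel `K_β(θ)`. -/
noncomputable def Kspec (β θ : ℝ) : ℝ :=
  (1 / Real.pi) * (θ ^ (β - 1) * Real.sin (β * Real.pi)) /
    (θ ^ (2 * β) + 2 * θ ^ β * Real.cos (β * Real.pi) + 1)


open scoped ENNReal

noncomputable def gmA (a t : ℝ) : ℝ≥0∞ :=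
  ENNReal.ofReal (if 0 < t then t ^ (a - 1) / Real.Gamma a else 0)

@[fun_prop]
lemma gmA_meas (a : ℝ) : Measurable (gmA a) := by
  unfold gmA
  exact (Measurable.ite measurableSet_Ioi (by fun_prop) (by fun_prop)).ennreal_ofReal

noncomputable def lapA (f : ℝ → ℝ≥0∞) (s : ℝ) : ℝ≥0∞ :=
  ∫⁻ t, ENNReal.ofReal (Real.exp (-(s * t))) * f t

noncomputable def cvA (f g : ℝ → ℝ≥0∞) (t : ℝ) : ℝ≥0∞ := ∫⁻ u, f (t - u) * g u

lemma lapA_gmA {a s : ℝ} (ha : 0 < a) (hs : 0 < s) :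
    lapA (gmA a) s = ENNReal.ofReal (s ^ (-a)) := by
  have h1 := ProbabilityTheory.lintegral_gammaPDF_eq_one ha hs
  have hG := Real.Gamma_pos_of_pos ha
  have hsa : 0 < s ^ a := Real.rpow_pos_of_pos hs a
  have : lapA (gmA a) s
      = ∫⁻ t, ENNReal.ofReal (s ^ (-a)) * ProbabilityTheory.gammaPDF a s t := by
    unfold lapA
    apply lintegral_congr_ae
    have h0 : ∀ᵐ t : ℝ, t ≠ 0 := by simp [ae_iff]
    filter_upwards [h0] with t ht
    rw [gmA, ProbabilityTheory.gammaPDF_eq]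
    rcases lt_or_gt_of_ne ht with h | h
    · simp [h.le.not_gt, h.not_ge]
    · rw [if_pos h, if_pos h.le, ← ENNReal.ofReal_mul (by positivity),
        ← ENNReal.ofReal_mul (by positivity), Real.rpow_neg hs.le]
      congr 1
      field_simp
  rw [this, lintegral_const_mul' _ _ (by simp), h1, mul_one]

lemma lint_scale {t : ℝ} (ht : 0 < t) (F : ℝ → ℝ≥0∞) (hF : Measurable F) :
    ∫⁻ u, F u = ENNReal.ofReal t * ∫⁻ x, F (t * x) := by
  conv_lhs => rw [← Real.smul_map_volume_mul_left ht.ne']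
  rw [lintegral_smul_measure, lintegral_map hF (by fun_prop), abs_of_pos ht, smul_eq_mul]

lemma cvA_gmA {a b : ℝ} (ha : 0 < a) (hb : 0 < b) (t : ℝ) :
    cvA (gmA a) (gmA b) t = gmA (a + b) t := by
  unfold cvA
  rcases le_or_gt t 0 with ht | ht
  · have : ∀ u, gmA a (t - u) * gmA b u = 0 := by
      intro u
      rcases le_or_gt u 0 with hu | hu
      · simp [gmA, hu.not_gt]
      · have : ¬ (0 < t - u) := by linarith
        simp only [gmA, if_neg this]; simp
    simp only [this]
    simp [gmA, ht.not_gt]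
  · rw [lint_scale ht _ (by fun_prop)]
    have hGa := Real.Gamma_pos_of_pos ha
    have hGb := Real.Gamma_pos_of_pos hb
    have hGab := Real.Gamma_pos_of_pos (add_pos ha hb)
    have key : ∀ x, gmA a (t - t * x) * gmA b (t * x)
        = ENNReal.ofReal (t ^ (a + b - 2) / Real.Gamma (a + b)) *
          ProbabilityTheory.betaPDF b a x := by
      intro x
      rw [ProbabilityTheory.betaPDF_eq]
      by_cases hx : 0 < x ∧ x < 1
      · obtain ⟨h0, h1⟩ := hx
        have e1 : 0 < 1 - x := by linarith
        have e2 : t - t * x = t * (1 - x) := by ring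
        have hp1 : 0 < t * (1 - x) := by positivity
        have hp2 : 0 < t * x := by positivity
        rw [e2, gmA, gmA, if_pos hp1, if_pos hp2, if_pos ⟨h0, h1⟩,
          ← ENNReal.ofReal_mul (by positivity), ← ENNReal.ofReal_mul (by positivity)]
        congr 1
        rw [Real.mul_rpow ht.le e1.le, Real.mul_rpow ht.le h0.le,
          show a + b - 2 = (a - 1) + (b - 1) by ring, Real.rpow_add ht, ProbabilityTheory.beta,
          add_comm b a]
        field_simp
      · rw [if_neg hx]
        by_cases h0 : 0 < x
        · have h1 : ¬ (0 < t - t * x) := by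
            have : 1 ≤ x := by by_contra h; exact hx ⟨h0, not_le.mp h⟩
            nlinarith
          simp only [gmA, if_neg h1]; simp
        · have h1 : ¬ (0 < t * x) := by
            have : x ≤ 0 := not_lt.mp h0
            nlinarith
          simp only [gmA, if_neg h1]; simp
    simp only [key]
    rw [lintegral_const_mul' _ _ (by simp), ProbabilityTheory.lintegral_betaPDF_eq_one hb ha,
      mul_one, gmA, if_pos ht, ← ENNReal.ofReal_mul ht.le]
    congr 1
    rw [show a + b - 1 = (a + b - 2) + 1 by ring, Real.rpow_add ht, Real.rpow_one]
    ring

lemma lapA_add {f g : ℝ → ℝ≥0∞} (hf : Measurable f) (s : ℝ) :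
    lapA (fun t => f t + g t) s = lapA f s + lapA g s := by
  unfold lapA
  simp only [mul_add]
  rw [lintegral_add_left (by fun_prop)]

lemma cvA_meas {f g : ℝ → ℝ≥0∞} (hf : Measurable f) (hg : Measurable g) :
    Measurable (cvA f g) := by
  unfold cvA
  apply Measurable.lintegral_prod_right'
    (f := fun z : ℝ × ℝ => f (z.1 - z.2) * g z.2)
  fun_prop

lemma cvA_add {f g h : ℝ → ℝ≥0∞} (hf : Measurable f) (hg : Measurable g) (t : ℝ) :
    cvA f (fun u => g u + h u) t = cvA f g t + cvA f h t := by
  unfold cvA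
  simp only [mul_add]
  rw [lintegral_add_left (by fun_prop)]

lemma cvA_tsum {f : ℝ → ℝ≥0∞} {g : ℕ → ℝ → ℝ≥0∞} (hf : Measurable f)
    (hg : ∀ n, Measurable (g n)) (t : ℝ) :
    cvA f (fun u => ∑' n, g n u) t = ∑' n, cvA f (g n) t := by
  unfold cvA
  simp only [← ENNReal.tsum_mul_left]
  rw [lintegral_tsum]
  intro n
  have := hg n
  fun_prop

lemma lapA_tsum {g : ℕ → ℝ → ℝ≥0∞} (hg : ∀ n, Measurable (g n)) (s : ℝ) :
    lapA (fun u => ∑' n, g n u) s = ∑' n, lapA (g n) s := by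
  unfold lapA
  simp only [← ENNReal.tsum_mul_left]
  rw [lintegral_tsum]
  intro n
  have := hg n
  fun_prop

lemma lapA_cvA {f g : ℝ → ℝ≥0∞} (hf : Measurable f) (hg : Measurable g) (s : ℝ) :
    lapA (cvA f g) s = lapA f s * lapA g s := by
  unfold lapA cvA
  have h1 : ∀ t : ℝ, ENNReal.ofReal (Real.exp (-(s * t))) * ∫⁻ u, f (t - u) * g u
      = ∫⁻ u, (ENNReal.ofReal (Real.exp (-(s * (t - u)))) * f (t - u)) *
          (ENNReal.ofReal (Real.exp (-(s * u))) * g u) := by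
    intro t
    rw [← lintegral_const_mul' _ _ (by simp)]
    congr 1; ext u
    rw [show -(s * t) = -(s * (t - u)) + -(s * u) by ring, Real.exp_add,
      ENNReal.ofReal_mul (Real.exp_pos _).le]
    ring
  simp only [h1]
  rw [lintegral_lintegral_swap (by fun_prop)]
  have h2 : ∀ u : ℝ, ∫⁻ t, (ENNReal.ofReal (Real.exp (-(s * (t - u)))) * f (t - u)) *
          (ENNReal.ofReal (Real.exp (-(s * u))) * g u)
      = (∫⁻ t, ENNReal.ofReal (Real.exp (-(s * t))) * f t) *
          (ENNReal.ofReal (Real.exp (-(s * u))) * g u) := by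
    intro u
    rw [lintegral_mul_const _ (by fun_prop),
      lintegral_sub_right_eq_self (fun t => ENNReal.ofReal (Real.exp (-(s * t))) * f t) u]
  simp only [h2]
  rw [lintegral_const_mul _ (by fun_prop)]

noncomputable def GA (β : ℝ) (n : ℕ) : ℝ → ℝ≥0∞ := gmA (n * β + β)
noncomputable def pA (β t : ℝ) : ℝ≥0∞ := ∑' n, GA β (2 * n) t
noncomputable def qA (β t : ℝ) : ℝ≥0∞ := ∑' n, GA β (2 * n + 1) t
noncomputable def fpA (β t : ℝ) : ℝ≥0∞ := pA β t - qA β t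
noncomputable def fmA (β t : ℝ) : ℝ≥0∞ := qA β t - pA β t

@[fun_prop]
lemma GA_meas (β : ℝ) (n : ℕ) : Measurable (GA β n) := gmA_meas _
@[fun_prop]
lemma pA_meas (β : ℝ) : Measurable (pA β) := by
  unfold pA; exact Measurable.tsum fun n => GA_meas β _
@[fun_prop]
lemma qA_meas (β : ℝ) : Measurable (qA β) := by
  unfold qA; exact Measurable.tsum fun n => GA_meas β _
@[fun_prop]
lemma fpA_meas (β : ℝ) : Measurable (fpA β) := by unfold fpA; fun_prop
@[fun_prop]
lemma fmA_meas (β : ℝ) : Measurable (fmA β) := by unfold fmA; fun_prop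

lemma GA_succ {β : ℝ} (hβ : 0 < β) (n : ℕ) (t : ℝ) :
    cvA (gmA β) (GA β n) t = GA β (n + 1) t := by
  unfold GA
  rw [cvA_gmA hβ (by positivity)]
  congr 1; push_cast; ring

lemma qA_eq {β : ℝ} (hβ : 0 < β) (t : ℝ) : cvA (gmA β) (pA β) t = qA β t := by
  unfold qA
  rw [show pA β = fun u => ∑' n, GA β (2 * n) u from rfl,
    cvA_tsum (gmA_meas _) (fun n => GA_meas β _)]
  simp only [GA_succ hβ]

lemma pA_eq {β : ℝ} (hβ : 0 < β) (t : ℝ) : gmA β t + cvA (gmA β) (qA β) t = pA β t := by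
  unfold pA
  rw [show qA β = fun u => ∑' n, GA β (2 * n + 1) u from rfl,
    cvA_tsum (gmA_meas _) (fun n => GA_meas β _)]
  simp only [GA_succ hβ]
  rw [tsum_eq_zero_add' (f := fun n => GA β (2 * n) t) ENNReal.summable]
  congr 1
  simp [GA]

lemma pq_lap {β : ℝ} (hβ : 0 < β) : lapA (fun t => ∑' n, GA β n t) 2 ≠ ⊤ := by
  rw [lapA_tsum (fun n => GA_meas β n)]
  have : ∀ n : ℕ, lapA (GA β n) 2
      = ENNReal.ofReal ((2:ℝ) ^ (-β)) * ENNReal.ofReal ((2:ℝ) ^ (-β)) ^ n := by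
    intro n
    rw [GA, lapA_gmA (by positivity) two_pos, ← ENNReal.ofReal_pow (by positivity),
      ← ENNReal.ofReal_mul (by positivity)]
    congr 1
    rw [← Real.rpow_natCast, ← Real.rpow_mul (by norm_num), ← Real.rpow_add two_pos]
    congr 1; ring
  simp only [this]
  rw [ENNReal.tsum_mul_left, ENNReal.tsum_geometric]
  apply ENNReal.mul_ne_top (by simp)
  rw [Ne, ENNReal.inv_eq_top, tsub_eq_zero_iff_le, not_le, ENNReal.ofReal_lt_one]
  exact Real.rpow_lt_one_of_one_lt_of_neg (by norm_num) (by linarith)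

lemma pq_fin {β : ℝ} (hβ : 0 < β) : ∀ᵐ t : ℝ, ∑' n, GA β n t ≠ ⊤ := by
  have h := pq_lap hβ
  have hm : Measurable (fun t => ∑' n, GA β n t) := Measurable.tsum fun n => GA_meas β n
  unfold lapA at h
  filter_upwards [ae_lt_top (by fun_prop) h] with t ht htop
  rw [htop, ENNReal.mul_top (by simp [Real.exp_pos])] at ht
  exact lt_irrefl _ ht

lemma pq_sum (β t : ℝ) : pA β t + qA β t = ∑' n, GA β n t :=
  tsum_even_add_odd (f := fun n => GA β n t) ENNReal.summable ENNReal.summable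

lemma fml_eq {β : ℝ} (hβ : 0 < β) {t : ℝ} (ht : 0 < t) (hfin : ∑' n, GA β n t ≠ ⊤) :
    ENNReal.ofReal (fML β t) = fpA β t := by
  have hpq := pq_sum β t
  rw [← hpq] at hfin
  obtain ⟨hp, hq⟩ := ENNReal.add_ne_top.mp hfin
  have hGf : ∀ n, GA β n t ≠ ⊤ := fun n => by simp [GA, gmA]
  have hGr : ∀ n : ℕ, (GA β n t).toReal = t ^ (β - 1) * ((t ^ β) ^ n / Real.Gamma (n * β + β)) := by
    intro n
    have := Real.Gamma_pos_of_pos (show 0 < n * β + β by positivity)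
    rw [GA, gmA, if_pos ht, ENNReal.toReal_ofReal (by positivity), ← Real.rpow_natCast,
      ← Real.rpow_mul ht.le, ← mul_div_assoc, ← Real.rpow_add ht]
    congr 2; ring
  have hsp : HasSum (fun n => (GA β (2 * n) t).toReal) (pA β t).toReal := by
    rw [pA, ENNReal.tsum_toReal_eq (fun n => hGf _)]
    exact ENNReal.hasSum_toReal hp
  have hsq : HasSum (fun n => (GA β (2 * n + 1) t).toReal) (qA β t).toReal := by
    rw [qA, ENNReal.tsum_toReal_eq (fun n => hGf _)]
    exact ENNReal.hasSum_toReal hq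
  have hs : HasSum (fun n : ℕ => (-1) ^ n * (GA β n t).toReal)
      ((pA β t).toReal + -(qA β t).toReal) := by
    apply HasSum.even_add_odd
    · simpa using hsp
    · simpa [pow_succ] using hsq.neg
  have : fML β t = (pA β t).toReal - (qA β t).toReal := by
    rw [sub_eq_add_neg, ← hs.tsum_eq, fML, ML2, ← tsum_mul_left]
    congr 1; ext n
    rw [hGr, neg_pow]; ring
  rw [this, ENNReal.ofReal_sub _ ENNReal.toReal_nonneg, ENNReal.ofReal_toReal hp,
    ENNReal.ofReal_toReal hq, fpA]

lemma fpm (β t : ℝ) : fpA β t + qA β t = fmA β t + pA β t := by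
  unfold fpA fmA
  rw [tsub_add_eq_max, tsub_add_eq_max, max_comm]

lemma ident {β : ℝ} (hβ : 0 < β) {t : ℝ} (hfin : ∑' n, GA β n t ≠ ⊤) :
    fmA β t + (gmA β t + cvA (gmA β) (fmA β) t) = fpA β t + cvA (gmA β) (fpA β) t := by
  rw [← pq_sum β t] at hfin
  obtain ⟨hp, hq⟩ := ENNReal.add_ne_top.mp hfin
  have hp' := pA_eq hβ t
  have hkq : cvA (gmA β) (qA β) t ≠ ⊤ := by
    rw [← hp'] at hp; exact (ENNReal.add_ne_top.mp hp).2
  have e : cvA (gmA β) (fpA β) t + cvA (gmA β) (qA β) t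
      = cvA (gmA β) (fmA β) t + cvA (gmA β) (pA β) t := by
    rw [← cvA_add (gmA_meas _) (fpA_meas _), ← cvA_add (gmA_meas _) (fmA_meas _)]
    congr 1; ext u; exact fpm β u
  rw [qA_eq hβ] at e
  refine (ENNReal.add_left_inj hkq).mp ?_
  calc _ = fmA β t + (gmA β t + cvA (gmA β) (qA β) t) + cvA (gmA β) (fmA β) t := by ring
    _ = fpA β t + (cvA (gmA β) (fmA β) t + qA β t) := by rw [hp', ← fpm]; ring
    _ = _ := by rw [← e]; ring

lemma lap_ident {β : ℝ} (hβ : 0 < β) {s : ℝ} (hs : 0 < s) :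
    lapA (fmA β) s + ENNReal.ofReal (1 / (1 + s ^ β)) = lapA (fpA β) s := by
  have hsb : 0 < s ^ β := Real.rpow_pos_of_pos hs β
  have h : lapA (fun t => fmA β t + (gmA β t + cvA (gmA β) (fmA β) t)) s
      = lapA (fun t => fpA β t + cvA (gmA β) (fpA β) t) s := by
    unfold lapA
    apply lintegral_congr_ae
    filter_upwards [pq_fin hβ] with t ht
    rw [ident hβ ht]
  rw [lapA_add (fmA_meas _), lapA_add (gmA_meas _), lapA_add (fpA_meas _),
    lapA_cvA (gmA_meas _) (fmA_meas _), lapA_cvA (gmA_meas _) (fpA_meas _), lapA_gmA hβ hs] at h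
  set k := ENNReal.ofReal (s ^ (-β)) with hk
  have hc : 1 + k = ENNReal.ofReal (1 + s ^ (-β)) := by
    rw [ENNReal.ofReal_add zero_le_one (by positivity), ENNReal.ofReal_one]
  have h0 : (1 + k) ≠ 0 := by simp
  have h1 : (1 + k) ≠ ⊤ := by simp [hk]
  refine (ENNReal.mul_right_inj h0 h1).mp ?_
  have hkk : (1 + k) * ENNReal.ofReal (1 / (1 + s ^ β)) = k := by
    rw [hc, ← ENNReal.ofReal_mul (by positivity), hk]
    congr 1
    rw [Real.rpow_neg hs.le]; field_simp; ring
  rw [mul_add, hkk]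
  calc _ = lapA (fmA β) s + (k + k * lapA (fmA β) s) := by ring
    _ = _ := by rw [h]; ring

lemma fp_zero {β t : ℝ} (ht : t ≤ 0) : fpA β t = 0 := by
  simp [fpA, pA, GA, gmA, ht.not_gt]

lemma fm_zero {β t : ℝ} (ht : t ≤ 0) : fmA β t = 0 := by
  simp [fmA, qA, GA, gmA, ht.not_gt]

lemma lap_le {f : ℝ → ℝ≥0∞} (hf : ∀ t ≤ 0, f t = 0) {s : ℝ} (hs : 0 < s) :
    lapA f s ≤ ∫⁻ t, f t := by
  apply lintegral_mono
  intro t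
  rcases le_or_gt t 0 with h | h
  · simp [hf t h]
  · have : ENNReal.ofReal (Real.exp (-(s * t))) ≤ 1 := by
      rw [ENNReal.ofReal_le_one, Real.exp_le_one_iff]
      have : 0 < s * t := by positivity
      linarith
    exact mul_le_of_le_one_left' this

lemma int_le {β : ℝ} (hβ : 0 < β) : (∫⁻ t, fmA β t) + 1 ≤ ∫⁻ t, fpA β t := by
  have hl : ∀ n : ℕ, lapA (fmA β) (1 / ((n:ℝ) + 1))
      + ENNReal.ofReal (1 / (1 + (1 / ((n:ℝ) + 1)) ^ β)) ≤ ∫⁻ t, fpA β t := fun n => by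
    rw [lap_ident hβ (by positivity)]
    exact lap_le (fun t ht => fp_zero ht) (by positivity)
  have t0 : Tendsto (fun n : ℕ => 1 / ((n:ℝ) + 1)) atTop (nhds 0) :=
    tendsto_one_div_add_atTop_nhds_zero_nat
  refine le_of_tendsto' (x := atTop) (Tendsto.add ?_ ?_) hl
  · unfold lapA
    apply lintegral_tendsto_of_tendsto_of_monotone
    · intro n; fun_prop
    · refine Eventually.of_forall fun t m n hmn => ?_
      dsimp only
      rcases le_or_gt t 0 with h | h
      · simp [fm_zero h]
      · gcongr
    · refine Eventually.of_forall fun t => ?_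
      have : Tendsto (fun n : ℕ => ENNReal.ofReal (Real.exp (-(1 / ((n:ℝ) + 1) * t)))) atTop
          (nhds 1) := by
        rw [← ENNReal.ofReal_one]
        apply ENNReal.tendsto_ofReal
        have := (Real.continuous_exp.tendsto _).comp (t0.mul_const t).neg
        simpa [Function.comp_def] using this
      simpa using ENNReal.Tendsto.mul_const this (Or.inl one_ne_zero)
  · rw [← ENNReal.ofReal_one]
    apply ENNReal.tendsto_ofReal
    have := (Real.continuousAt_rpow_const 0 β (Or.inr hβ.le)).tendsto.comp t0
    rw [Real.zero_rpow hβ.ne'] at this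
    have := (this.const_add 1).inv₀ (by norm_num)
    simpa using this

/-- For `β ∈ (0,1)`, a Mittag-Leffler distributed positive random variable has
infinite mean: `∫_0^∞ t f_β(t) dt = ∞`. -/
theorem mittagLeffler_infinite_mean (β : ℝ) (hβ : β ∈ Set.Ioo (0:ℝ) 1) :
    ∫⁻ t in Set.Ioi (0:ℝ), ENNReal.ofReal (t * fML β t) = ⊤ := by
  obtain ⟨hb, hb1⟩ := hβ
  have h1 : ∫⁻ t in Set.Ioi (0:ℝ), ENNReal.ofReal (t * fML β t)
      = ∫⁻ t, ENNReal.ofReal t * fpA β t := by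
    rw [← lintegral_indicator measurableSet_Ioi]
    apply lintegral_congr_ae
    filter_upwards [pq_fin hb] with t ht
    by_cases h : 0 < t
    · rw [Set.indicator_of_mem (by exact h), ENNReal.ofReal_mul h.le, fml_eq hb h ht]
    · rw [Set.indicator_of_notMem (by exact h), fp_zero (not_lt.mp h), mul_zero]
  rw [h1]
  by_contra hM
  set M := ∫⁻ t, ENNReal.ofReal t * fpA β t with hMdef
  have hL2 : lapA (fpA β) 2 ≠ ⊤ := by
    refine ne_top_of_le_ne_top (pq_lap hb) ?_
    unfold lapA
    apply lintegral_mono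
    intro t
    dsimp only
    gcongr
    rw [← pq_sum]
    exact tsub_le_self.trans le_self_add
  have hle : ∀ s : ℝ, 0 < s → ∫⁻ t, fpA β t ≤ lapA (fpA β) s + ENNReal.ofReal s * M := by
    intro s hs
    rw [hMdef, ← lintegral_const_mul' _ _ (by simp), lapA, ← lintegral_add_left (by fun_prop)]
    apply lintegral_mono
    intro t
    dsimp only
    rcases le_or_gt t 0 with h | h
    · simp [fp_zero h]
    · rw [← mul_assoc, ← add_mul, ← ENNReal.ofReal_mul hs.le,
        ← ENNReal.ofReal_add (Real.exp_pos _).le (by positivity)]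
      have : (1:ℝ≥0∞) ≤ ENNReal.ofReal (Real.exp (-(s * t)) + s * t) := by
        rw [ENNReal.one_le_ofReal]
        have := Real.add_one_le_exp (-(s * t))
        linarith
      exact le_mul_of_one_le_left' this
  have hP : ∫⁻ t, fpA β t ≠ ⊤ :=
    ne_top_of_le_ne_top (ENNReal.add_ne_top.mpr ⟨hL2, ENNReal.mul_ne_top (by simp) hM⟩)
      (hle 2 two_pos)
  have hN : ∫⁻ t, fmA β t ≠ ⊤ :=
    ne_top_of_le_ne_top hP (le_self_add.trans (int_le hb))
  have hfin : ∀ s : ℝ, 0 < s → 1 ≤ 1 / (1 + s ^ β) + s * M.toReal := by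
    intro s hs
    have hsb : 0 < s ^ β := Real.rpow_pos_of_pos hs β
    have a : (∫⁻ t, fmA β t) + 1
        ≤ (∫⁻ t, fmA β t) + (ENNReal.ofReal (1 / (1 + s ^ β)) + ENNReal.ofReal s * M) := by
      refine (int_le hb).trans ((hle s hs).trans ?_)
      rw [← lap_ident hb hs, add_assoc]
      gcongr
      exact lap_le (fun t ht => fm_zero ht) hs
    have b := (ENNReal.add_le_add_iff_left hN).mp a
    have hM' := ENNReal.toReal_nonneg (a := M)
    rw [← ENNReal.ofReal_toReal hM, ← ENNReal.ofReal_mul hs.le,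
      ← ENNReal.ofReal_add (by positivity) (by positivity), ENNReal.one_le_ofReal] at b
    exact b
  -- contradiction as `s → 0`
  have hbd : ∀ s : ℝ, 0 < s → s ≤ 1 → s ^ (β - 1) ≤ 2 * M.toReal := by
    intro s hs hs1
    have hsb : 0 < s ^ β := Real.rpow_pos_of_pos hs β
    have hsb1 : s ^ β ≤ 1 := Real.rpow_le_one hs.le hs1 hb.le
    have h := hfin s hs
    have hM' := ENNReal.toReal_nonneg (a := M)
    rw [Real.rpow_sub_one hs.ne', div_le_iff₀ hs]
    have h2 : (1 + s ^ β) * 1 ≤ (1 + s ^ β) * (1 / (1 + s ^ β) + s * M.toReal) := by gcongr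
    rw [mul_add, mul_one_div_cancel (by positivity)] at h2
    have h3 : (1 + s ^ β) * (s * M.toReal) ≤ 2 * (s * M.toReal) := by gcongr; linarith
    linarith
  have ht : Tendsto (fun x : ℝ => x ^ (1 - β)) atTop atTop :=
    tendsto_rpow_atTop (by linarith)
  obtain ⟨x, hx1, hx2⟩ :=
    ((ht.eventually_gt_atTop (2 * M.toReal)).and (eventually_ge_atTop 1)).exists
  have hx0 : 0 < x := by linarith
  have := hbd x⁻¹ (by positivity) (inv_le_one_of_one_le₀ hx2)
  rw [Real.inv_rpow hx0.le, ← Real.rpow_neg hx0.le, neg_sub] at this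
  linarith
end

section
/- Let β ∈ (0,1]. The function g(t) = E_β(-t^β) is antitone (non-increasing) on [0,∞), satisfies g(0) = 1, and tends to 0 as t → ∞. -/
open MeasureTheory Set Filter

noncomputable def Fs (a : ℕ → ℝ) (x : ℝ) : ℝ := ∑' n : ℕ, (-x)^n / (n.factorial : ℝ) * a n

lemma Fs_summable (a : ℕ → ℝ) (ha : ∀ n, 0 ≤ a n ∧ a n ≤ 1) (x : ℝ) :
    Summable (fun n : ℕ => (-x)^n / (n.factorial : ℝ) * a n) := by
  refine Summable.of_norm_bounded (g := fun n : ℕ => |x|^n / (n.factorial : ℝ)) (Real.summable_pow_div_factorial _) ?_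
  intro n
  rw [norm_mul, norm_div, norm_pow, Real.norm_eq_abs, abs_neg, Real.norm_natCast, Real.norm_eq_abs, abs_of_nonneg (ha n).1]
  exact mul_le_of_le_one_right (by positivity) (ha n).2

structure Good (C : ℝ) (a : ℕ → ℝ) : Prop where
  bd : ∀ n, 0 ≤ a n ∧ a n ≤ 1
  anti : AntitoneOn (Fs a) (Set.Ici 0)
  nn : ∀ x, 0 ≤ x → 0 ≤ Fs a x
  dec : ∀ x, 0 < x → Fs a x ≤ C * x ^ (-(1/2) : ℝ)

lemma Fs_int (j : ℕ) (a : ℕ → ℝ) (ha : ∀ n, 0 ≤ a n ∧ a n ≤ 1) (x : ℝ) :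
    Fs (fun n => a n * ((j+1 : ℝ) / (j + 1 + n))) x = ∫ u in (0:ℝ)..1, (j+1) * u^j * Fs a (x*u) := by
  have h := intervalIntegral.hasSum_integral_of_dominated_convergence (a := (0:ℝ)) (b := 1)
    (μ := volume) (F := fun (n : ℕ) (u:ℝ) => (j+1) * u^j * ((-(x*u))^n / (n.factorial : ℝ) * a n))
    (f := fun u => (j+1) * u^j * Fs a (x*u))
    (fun n _ => (j+1) * (|x|^n / (n.factorial : ℝ))) ?_ ?_ ?_ ?_ ?_
  · rw [← h.tsum_eq, Fs]
    congr 1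
    ext n
    have : ∀ u : ℝ, (j+1) * u^j * ((-(x*u))^n / (n.factorial : ℝ) * a n)
        = ((j+1) * ((-x)^n / (n.factorial : ℝ) * a n)) * u^(j+n) := by
      intro u
      rw [show -(x*u) = (-x)*u by ring, mul_pow, pow_add]; ring
    simp_rw [this]
    rw [intervalIntegral.integral_const_mul, integral_pow]
    have : (j:ℝ)+1+n ≠ 0 := by positivity
    have : (n.factorial:ℝ) ≠ 0 := by positivity
    push_cast
    simp
    field_simp
    ring
  · intro n
    apply Continuous.aestronglyMeasurable
    fun_prop
  · intro n
    refine Filter.Eventually.of_forall fun u hu => ?_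
    rw [Set.uIoc_of_le zero_le_one] at hu
    have h1 : |u| ≤ 1 := by rw [abs_of_pos hu.1]; exact hu.2
    simp only [norm_mul, norm_div, norm_pow, Real.norm_eq_abs, abs_neg, abs_mul, mul_pow, Nat.abs_cast, mul_assoc]
    rw [abs_of_nonneg (ha n).1, abs_of_nonneg (by positivity : (0:ℝ) ≤ j+1)]
    gcongr
    calc |u|^j * (|x|^n * |u|^n / n.factorial * a n) ≤ 1 * (|x|^n * 1 / n.factorial * 1) := by
          have := ha n
          have := this.1
          gcongr
          · exact pow_le_one₀ (abs_nonneg _) h1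
          · exact pow_le_one₀ (abs_nonneg _) h1
          · exact (ha n).2
      _ = _ := by ring
  · refine Filter.Eventually.of_forall fun u hu => ?_
    exact (Real.summable_pow_div_factorial _).mul_left _
  · exact intervalIntegrable_const
  · refine Filter.Eventually.of_forall fun u hu => ?_
    exact ((Fs_summable a ha _).hasSum).mul_left _

lemma good_int (C : ℝ) (j : ℕ) (a : ℕ → ℝ) (h : Good C a) :
    Good (C * ((j+1) / (j+1/2))) (fun n => a n * ((j+1 : ℝ) / (j + 1 + n))) := by
  have hI : ∀ x, 0 ≤ x → IntervalIntegrable (fun u => (j+1) * u^j * Fs a (x*u)) volume (0:ℝ) 1 := by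
    intro x hx
    apply IntervalIntegrable.continuousOn_mul
    · apply AntitoneOn.intervalIntegrable
      rw [Set.uIcc_of_le zero_le_one]
      intro u hu v hv huv
      exact h.anti (mul_nonneg hx hu.1) (mul_nonneg hx hv.1) (mul_le_mul_of_nonneg_left huv hx)
    · fun_prop
  constructor
  · intro n
    have := h.bd n
    refine ⟨mul_nonneg this.1 (by positivity), ?_⟩
    apply mul_le_one₀ this.2 (by positivity)
    rw [div_le_one (by positivity)]
    have : (0:ℝ) ≤ n := by positivity
    linarith
  · intro x hx y hy hxy
    rw [Fs_int j a h.bd, Fs_int j a h.bd]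
    apply intervalIntegral.integral_mono_on zero_le_one (hI y hy) (hI x hx)
    intro u hu
    have := hu.1
    refine mul_le_mul_of_nonneg_left ?_ (by positivity)
    exact h.anti (mul_nonneg hx hu.1) (mul_nonneg hy hu.1) (mul_le_mul_of_nonneg_right hxy hu.1)
  · intro x hx
    rw [Fs_int j a h.bd]
    apply intervalIntegral.integral_nonneg zero_le_one
    intro u hu
    have := hu.1
    have := h.nn (x*u) (mul_nonneg hx hu.1)
    positivity
  · intro x hx
    rw [Fs_int j a h.bd]
    have hJ : IntervalIntegrable (fun u:ℝ => ((j+1) * C * x^(-(1/2):ℝ)) * u^((j:ℝ)+(-(1/2)))) volume (0:ℝ) 1 := by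
      apply IntervalIntegrable.const_mul
      apply intervalIntegral.intervalIntegrable_rpow'
      have : (0:ℝ) ≤ j := by positivity
      linarith
    have := intervalIntegral.integral_mono_on_of_le_Ioo zero_le_one (hI x hx.le) hJ ?_
    · refine this.trans (le_of_eq ?_)
      rw [intervalIntegral.integral_const_mul, integral_rpow]
      · have : (j:ℝ) + -(1/2) + 1 = j + 1/2 := by ring
        rw [this, Real.one_rpow, Real.zero_rpow (by positivity)]
        ring
      · left
        have : (0:ℝ) ≤ j := by positivity
        linarith
    · intro u hu
      have hu0 := hu.1
      have := h.dec (x*u) (mul_pos hx hu.1)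
      rw [Real.mul_rpow hx.le hu0.le] at this
      rw [Real.rpow_add hu0, Real.rpow_natCast]
      calc _ ≤ (j+1) * u^j * (C * (x ^ (-(1/2):ℝ) * u ^ (-(1/2):ℝ))) := by gcongr
        _ = _ := by ring

lemma good_mix (β C D : ℝ) (hβ : 0 ≤ β) (hβ' : β ≤ 1) (a b : ℕ → ℝ) (ha : Good C a) (hb : Good D b) :
    Good (β * C + (1-β) * D) (fun n => β * a n + (1-β) * b n) := by
  have h1 : 0 ≤ 1 - β := by linarith
  have e : ∀ x, Fs (fun n => β * a n + (1-β) * b n) x = β * Fs a x + (1-β) * Fs b x := by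
    intro x
    unfold Fs
    rw [← tsum_mul_left, ← tsum_mul_left, ← Summable.tsum_add]
    · congr 1; ext n; ring
    · exact (Fs_summable a ha.bd x).mul_left _
    · exact (Fs_summable b hb.bd x).mul_left _
  constructor
  · intro n
    have := ha.bd n
    have h2 := hb.bd n
    constructor
    · have := this.1
      have := h2.1
      positivity
    · nlinarith
  · intro x hx y hy hxy
    rw [e, e]
    have := ha.anti hx hy hxy
    have := hb.anti hx hy hxy
    gcongr
  · intro x hx
    rw [e]
    have := ha.nn x hx
    have := hb.nn x hx
    positivity
  · intro x hx
    rw [e, add_mul, mul_assoc, mul_assoc]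
    have := ha.dec x hx
    have := hb.dec x hx
    gcongr

lemma good_zero : Good 1 (fun _ => 1) := by
  have e : ∀ x, Fs (fun _ => 1) x = Real.exp (-x) := by
    intro x
    unfold Fs
    rw [Real.exp_eq_exp_ℝ, NormedSpace.exp_eq_tsum_div]
    simp
  constructor
  · intro n; simp
  · intro x _ y _ hxy
    rw [e, e]; gcongr
  · intro x _; rw [e]; positivity
  · intro x hx
    rw [e, one_mul, Real.rpow_neg hx.le, Real.exp_neg, ← Real.sqrt_eq_rpow]
    apply inv_anti₀ (Real.sqrt_pos.2 hx)
    apply Real.sqrt_le_iff.2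
    refine ⟨by positivity, ?_⟩
    have := Real.add_one_le_exp x
    nlinarith

lemma good_prod (β : ℝ) (hβ : 0 ≤ β) (hβ' : β ≤ 1) (m : ℕ) :
    Good (∏ j ∈ Finset.range m, ((1 - β/2 + j) / (1/2 + j)))
      (fun n => ∏ j ∈ Finset.range m, ((1 + n*β + j) / (1 + n + j))) := by
  induction m with
  | zero => simpa using good_zero
  | succ m ih =>
    have := good_mix β _ _ hβ hβ' _ _ ih (good_int _ m _ ih)
    convert this using 1
    · rw [Finset.prod_range_succ]
      have : (1/2 + (m:ℝ)) ≠ 0 := by positivity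
      have h2 : ((m:ℝ) + 1/2) = (1/2 + (m:ℝ)) := by ring
      rw [h2]
      field_simp
      ring
    · ext n
      rw [Finset.prod_range_succ]
      have : (1 + (n:ℝ) + m) ≠ 0 := by positivity
      have h2 : ((m:ℝ) + 1 + n) = (1 + (n:ℝ) + m) := by ring
      rw [h2]
      field_simp
      ring

lemma prod_bd (β : ℝ) (hβ : 0 ≤ β) (hβ' : β ≤ 1) (n m : ℕ) :
    ∏ j ∈ Finset.range m, ((1 + n*β + j) / (1 + n + j)) ≤ ((n + 1 : ℝ)/(m+n+1)) ^ (n*(1-β)) := by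
  have h1 : 0 ≤ 1 - β := by linarith
  induction m with
  | zero => 
    have : (n:ℝ) + 1 ≠ 0 := by positivity
    simp [this]
  | succ m ih =>
    rw [Finset.prod_range_succ]
    have e : ((n + 1 : ℝ)/((m+1:ℕ)+n+1)) = ((n + 1 : ℝ)/(m+n+1)) * ((m+n+1)/(m+n+2)) := by
      push_cast; field_simp; ring
    rw [e, Real.mul_rpow (by positivity) (by positivity)]
    apply mul_le_mul ih ?_ (by positivity) (by positivity)
    set y : ℝ := m+n+1 with hy
    have hy0 : 0 < y := by positivity
    have e1 : ((1 + n*β + m) / (1 + n + m) : ℝ) = 1 - n*(1-β)/y := by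
      have : (1 + n + m : ℝ) = y := by rw [hy]; ring
      rw [this]; field_simp; rw [hy]; ring
    have e2 : (m+n+2 : ℝ) = y + 1 := by rw [hy]; ring
    rw [e1, e2, Real.rpow_def_of_pos (by positivity)]
    have := Real.add_one_le_exp (-(n*(1-β)/y))
    calc 1 - n*(1-β)/y ≤ Real.exp (-(n*(1-β)/y)) := by linarith
      _ ≤ _ := by
        apply Real.exp_le_exp.2
        have h3 := Real.one_sub_inv_le_log_of_pos (show 0 < y/(y+1) by positivity)
        have h4 : 1 - (y/(y+1))⁻¹ = -(1/y) := by field_simp; ring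
        rw [h4] at h3
        have := mul_le_mul_of_nonneg_right h3 (show 0 ≤ n*(1-β) by positivity)
        calc _ = -(1/y) * (n*(1-β)) := by ring
          _ ≤ _ := this

lemma sum_bd (β : ℝ) (hβ : 0 < β) (x : ℝ) (hx : 0 ≤ x) :
    Summable (fun n : ℕ => x^n / (n.factorial : ℝ) * ((n:ℝ)+1)^(n*(1-β))) := by
  have ht : Filter.Tendsto (fun n : ℕ => Real.exp 1 * x * ((n:ℝ)+1)^(-β)) Filter.atTop (nhds (Real.exp 1 * x * 0)) := by
    apply Filter.Tendsto.const_mul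
    exact (tendsto_rpow_neg_atTop hβ).comp (Filter.tendsto_atTop_add_const_right _ _ tendsto_natCast_atTop_atTop)
  rw [mul_zero] at ht
  have he := ht.eventually (gt_mem_nhds (show (0:ℝ) < 1/2 by norm_num))
  refine Summable.of_norm_bounded_eventually_nat (g := fun n => Real.exp 1 * (1/2:ℝ)^n) (summable_geometric_two.mul_left _) ?_
  filter_upwards [he] with n hn
  rw [Real.norm_of_nonneg (by positivity)]
  have h1 := Real.pow_div_factorial_le_exp ((n:ℝ)+1) (by positivity) n
  have h2 : ((n:ℝ)+1)^(n*(1-β)) = ((n:ℝ)+1)^n * (((n:ℝ)+1)^(-β))^n := by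
    rw [← Real.rpow_natCast, ← Real.rpow_natCast, ← Real.rpow_mul (by positivity), ← Real.rpow_add (by positivity)]
    congr 1; ring
  calc _ = (((n:ℝ)+1)^n / n.factorial) * (x^n * (((n:ℝ)+1)^(-β))^n) := by rw [h2]; ring
    _ ≤ Real.exp (n+1) * (x^n * (((n:ℝ)+1)^(-β))^n) := by gcongr
    _ = Real.exp 1 * (Real.exp 1 * x * ((n:ℝ)+1)^(-β))^n := by
      rw [Real.exp_add, mul_pow, mul_pow, ← Real.exp_nat_mul]; ring_nf
    _ ≤ _ := by gcongr

lemma gs (p q : ℝ) (hp : 0 < p) (hq : 0 < q) (m : ℕ) (hm : 0 < m) :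
    Real.GammaSeq p m / Real.GammaSeq q m = (m:ℝ)^(p-q) * ∏ j ∈ Finset.range (m+1), ((q+j)/(p+j)) := by
  unfold Real.GammaSeq
  have hm' : (0:ℝ) < m := by positivity
  rw [Real.rpow_sub hm', Finset.prod_div_distrib]
  have h1 : ∏ j ∈ Finset.range (m+1), (p+j) ≠ 0 := Finset.prod_ne_zero_iff.2 fun j _ => by positivity
  have h2 : ∏ j ∈ Finset.range (m+1), (q+j) ≠ 0 := Finset.prod_ne_zero_iff.2 fun j _ => by positivity
  have : (m:ℝ)^q ≠ 0 := by positivity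
  field_simp

lemma gs_lim (p q : ℝ) (hq : 0 < q) :
    Filter.Tendsto (fun m => Real.GammaSeq p m / Real.GammaSeq q m) Filter.atTop (nhds (Real.Gamma p / Real.Gamma q)) :=
  (Real.GammaSeq_tendsto_Gamma p).div (Real.GammaSeq_tendsto_Gamma q) (Real.Gamma_pos_of_pos hq).ne'

noncomputable def Ph (β : ℝ) (m : ℕ) (x : ℝ) : ℝ :=
  Fs (fun n => ∏ j ∈ Finset.range (m+1), ((1 + n*β + j) / (1 + n + j))) ((m:ℝ)^(1-β) * x)

lemma Ph_lim (β : ℝ) (hβ : 0 < β) (hβ' : β ≤ 1) (x : ℝ) (hx : 0 ≤ x) :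
    Filter.Tendsto (fun m => Ph β m x) Filter.atTop (nhds (ML β (-x))) := by
  unfold Ph Fs ML ML2
  refine tendsto_tsum_of_dominated_convergence (sum_bd β hβ x hx) ?_ ?_
  · intro n
    have h := (gs_lim (1+n) (1+n*β) (by positivity)).const_mul ((-x)^n / (n.factorial:ℝ))
    have e : (-x)^n / Real.Gamma (n*β+1) = (-x)^n / (n.factorial:ℝ) * (Real.Gamma (1+n) / Real.Gamma (1+n*β)) := by
      rw [add_comm (1:ℝ) n, Real.Gamma_nat_eq_factorial, add_comm]
      have : (n.factorial:ℝ) ≠ 0 := by positivity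
      field_simp
    rw [e]
    refine h.congr' ?_
    filter_upwards [Filter.eventually_gt_atTop 0] with m hm
    rw [gs _ _ (by positivity) (by positivity) m hm]
    have : (1 + n - (1 + n*β) : ℝ) = (1-β)*n := by ring
    rw [this, Real.rpow_mul (by positivity), Real.rpow_natCast, ← mul_neg, mul_pow]
    ring
  · filter_upwards [Filter.eventually_gt_atTop 0] with m hm n
    have hp := prod_bd β hβ.le hβ' n (m+1)
    have hm' : (0:ℝ) < m := by positivity
    have h0 : 0 ≤ ∏ j ∈ Finset.range (m+1), ((1 + n*β + j) / (1 + n + j)) :=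
      Finset.prod_nonneg fun j _ => by positivity
    have h1 : 0 ≤ 1 - β := by linarith
    rw [norm_mul, norm_div, norm_pow, norm_neg, Real.norm_of_nonneg h0, Real.norm_natCast,
      Real.norm_of_nonneg (by positivity), mul_pow]
    rw [← Real.rpow_natCast (_ ^ (1-β)), ← Real.rpow_mul hm'.le, mul_comm (1-β)]
    calc _ ≤ (m:ℝ)^(n*(1-β)) * x^n / n.factorial * ((n + 1 : ℝ)/((m+1:ℕ)+n+1)) ^ (n*(1-β)) := by gcongr
      _ = x^n / n.factorial * (m * ((n + 1 : ℝ)/((m+1:ℕ)+n+1))) ^ (n*(1-β)) := by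
        rw [Real.mul_rpow (by positivity) (by positivity)]; ring
      _ ≤ _ := by
        gcongr
        rw [← mul_div_assoc, div_le_iff₀ (by positivity)]
        push_cast
        have : (0:ℝ) ≤ n := by positivity
        nlinarith

lemma main' (β : ℝ) (hβ : 0 < β) (hβ' : β ≤ 1) :
    AntitoneOn (fun x => ML β (-x)) (Set.Ici 0) ∧ (∀ x, 0 ≤ x → 0 ≤ ML β (-x)) ∧
    ∃ C : ℝ, ∀ x, 0 < x → ML β (-x) ≤ C * x ^ (-(1/2) : ℝ) := by
  have hg := fun m : ℕ => good_prod β hβ.le hβ' (m+1)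
  refine ⟨?_, ?_, Real.Gamma (1/2) / Real.Gamma (1-β/2), ?_⟩
  · intro x hx y hy hxy
    have hx : 0 ≤ x := hx
    have hy : 0 ≤ y := hy
    refine le_of_tendsto_of_tendsto' (Ph_lim β hβ hβ' y hy) (Ph_lim β hβ hβ' x hx) fun m => ?_
    exact (hg m).anti (show 0 ≤ (m:ℝ)^(1-β) * x by positivity) (show 0 ≤ (m:ℝ)^(1-β) * y by positivity) (by gcongr)
  · intro x hx
    exact ge_of_tendsto' (Ph_lim β hβ hβ' x hx) fun m => (hg m).nn _ (by positivity)
  · intro x hx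
    have hq : 0 < 1 - β/2 := by linarith
    refine le_of_tendsto_of_tendsto (Ph_lim β hβ hβ' x hx.le) ((gs_lim (1/2) (1-β/2) hq).mul_const _) ?_
    filter_upwards [Filter.eventually_gt_atTop 0] with m hm
    have hm' : (0:ℝ) < m := by positivity
    refine ((hg m).dec _ (by positivity)).trans (le_of_eq ?_)
    rw [gs _ _ (by norm_num) hq m hm, Real.mul_rpow (by positivity) hx.le, ← Real.rpow_mul hm'.le,
      show (1-β) * (-(1/2)) = 1/2 - (1-β/2) by ring]
    ring

/-- For `β ∈ (0,1]`, `g(t) = E_β(-t^β)` is non-increasing on `[0,∞)`,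
equals `1` at `t = 0`, and tends to `0` as `t → ∞`. -/
theorem mittagLeffler_survival_props (β : ℝ) (hβ : β ∈ Set.Ioc (0:ℝ) 1) :
    AntitoneOn (fun t : ℝ => ML β (-(t ^ β))) (Set.Ici 0) ∧
    ML β (-((0:ℝ) ^ β)) = 1 ∧
    Filter.Tendsto (fun t : ℝ => ML β (-(t ^ β))) Filter.atTop (nhds 0) := by

  obtain ⟨h0, h1⟩ := hβ
  obtain ⟨ha, hn, C, hC⟩ := main' β h0 h1
  refine ⟨?_, ?_, ?_⟩
  · intro s hs t ht hst
    have hs : 0 ≤ s := hs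
    have ht : 0 ≤ t := ht
    exact ha (show 0 ≤ s ^ β by positivity) (show 0 ≤ t ^ β by positivity)
      (Real.rpow_le_rpow hs hst h0.le)
  · rw [Real.zero_rpow h0.ne']
    unfold ML ML2
    rw [tsum_eq_single 0]
    · simp
    · intro n hn
      simp [hn]
  · have h2 : Filter.Tendsto (fun t : ℝ => C * (t ^ β) ^ (-(1/2) : ℝ)) Filter.atTop (nhds (C * 0)) :=
      ((tendsto_rpow_neg_atTop (by norm_num)).comp (tendsto_rpow_atTop h0)).const_mul C
    rw [mul_zero] at h2
    refine tendsto_of_tendsto_of_tendsto_of_le_of_le' tendsto_const_nhds h2 ?_ ?_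
    · filter_upwards [Filter.eventually_gt_atTop 0] with t ht
      exact hn _ (by positivity)
    · filter_upwards [Filter.eventually_gt_atTop 0] with t ht
      exact hC _ (by positivity)
end

section
/- Let β ∈ (0,1). The Mittag-Leffler density decays as a power law with exponent β+1: lim_{t→∞} t^{β+1} · f_β(t) = β/Γ(1-β), where f_β(t) = t^{β-1} E_{β,β}(-t^β). -/
open MeasureTheory Set Filter

lemma rhp_open : IsOpen {z : ℂ | 0 < z.re} := isOpen_lt continuous_const Complex.continuous_re
lemma rhp_pre : IsPreconnected {z : ℂ | 0 < z.re} := (convex_halfSpace_re_gt 0).isPreconnected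

lemma rhp_nhds (x : ℂ) (hx : 0 < x.re) : {z : ℂ | x.re / 2 < z.re} ∈ nhds x :=
  (isOpen_lt continuous_const Complex.continuous_re).mem_nhds (by
    show x.re / 2 < x.re
    linarith)

lemma laplace_int (s δ : ℝ) (hs : 0 < s) (hδ : 0 < δ) :
    IntegrableOn (fun v : ℝ => v ^ (s-1) * Real.exp (-(δ * v))) (Ioi 0) := by
  have := integrableOn_rpow_mul_exp_neg_mul_rpow (p := 1) (s := s - 1) (b := δ) (by linarith) one_pos hδ
  simpa using this

lemma laplace_norm (s : ℝ) (z : ℂ) (v : ℝ) (hv : 0 < v) :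
    ‖(v:ℂ) ^ ((s:ℂ)-1) * Complex.exp (-(z * v))‖ = v ^ (s-1) * Real.exp (-(z.re * v)) := by
  rw [norm_mul, Complex.norm_cpow_eq_rpow_re_of_pos hv, Complex.norm_exp]
  simp

lemma laplace_meas (s : ℂ) (z : ℂ) : AEStronglyMeasurable
    (fun v : ℝ => (v:ℂ) ^ s * Complex.exp (-(z * v))) (volume.restrict (Ioi 0)) := by
  refine ContinuousOn.aestronglyMeasurable ?_ measurableSet_Ioi
  refine ContinuousOn.mul ?_ (by fun_prop)
  intro v hv
  exact (Complex.continuousAt_ofReal_cpow_const _ _ (Or.inr (ne_of_gt hv))).continuousWithinAt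

lemma laplace_diff (s : ℝ) (hs : 0 < s) : DifferentiableOn ℂ
    (fun z : ℂ => ∫ v : ℝ in Ioi 0, (v:ℂ) ^ ((s:ℂ)-1) * Complex.exp (-(z * v))) {z : ℂ | 0 < z.re} := by
  intro x hx
  have hx : 0 < x.re := hx
  refine (DifferentiableAt.differentiableWithinAt ?_)
  refine (hasDerivAt_integral_of_dominated_loc_of_deriv_le (rhp_nhds x hx) 
    (F := fun (z : ℂ) (v : ℝ) => (v:ℂ) ^ ((s:ℂ)-1) * Complex.exp (-(z * v)))
    (F' := fun (z : ℂ) (v : ℝ) => -(v * ((v:ℂ) ^ ((s:ℂ)-1) * Complex.exp (-(z * v)))))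
    (bound := fun v => v ^ (s + 1 - 1) * Real.exp (-(x.re/2 * v)))
    (Eventually.of_forall fun z => laplace_meas _ _) ?_ ?_ ?_ (laplace_int _ _ (by linarith) (by linarith)) ?_).2.differentiableAt
  · refine (laplace_int s x.re hs hx).mono' (laplace_meas _ _) ?_
    filter_upwards [ae_restrict_mem measurableSet_Ioi] with v hv
    exact (laplace_norm s x v hv).le
  · exact (Complex.continuous_ofReal.aestronglyMeasurable.mul (laplace_meas _ _)).neg
  · filter_upwards [ae_restrict_mem measurableSet_Ioi] with v hv z hz
    have hv : 0 < v := hv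
    have hz : x.re / 2 < z.re := hz
    rw [norm_neg, norm_mul, laplace_norm s z v hv, show s + 1 - 1 = 1 + (s - 1) by ring,
      Real.rpow_add hv, Real.rpow_one, Complex.norm_real, Real.norm_of_nonneg hv.le, mul_assoc]
    gcongr
  · filter_upwards with v z hz
    have h : HasDerivAt (fun z : ℂ => -(z * v)) (-(v:ℂ)) z := by
      simpa using ((hasDerivAt_id z).mul_const (v:ℂ)).fun_neg
    convert! (h.cexp.const_mul ((v:ℂ) ^ ((s:ℂ)-1))) using 1
    ring

lemma laplace_pow (s : ℝ) (hs : 0 < s) (z : ℂ) (hz : 0 < z.re) :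
    ∫ v : ℝ in Ioi 0, (v:ℂ) ^ ((s:ℂ)-1) * Complex.exp (-(z * v)) = Complex.Gamma s * z ^ (-(s:ℂ)) := by
  have h1 := (laplace_diff s hs).analyticOnNhd rhp_open
  have h2 : AnalyticOnNhd ℂ (fun z : ℂ => Complex.Gamma s * z ^ (-(s:ℂ))) {z : ℂ | 0 < z.re} := by
    refine DifferentiableOn.analyticOnNhd ?_ rhp_open
    intro z hz
    refine (DifferentiableAt.const_mul ?_ _).differentiableWithinAt
    exact differentiableAt_id.cpow_const (Or.inl hz)
  refine h1.eqOn_of_preconnected_of_frequently_eq h2 rhp_pre (z₀ := 1) (by simp) ?_ hz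
  have ht : Tendsto (fun t : ℝ => (t : ℂ)) (nhdsWithin 1 (Ioi 1)) (nhdsWithin 1 {1}ᶜ) := by
    refine tendsto_nhdsWithin_iff.2 ⟨?_, ?_⟩
    · exact (Complex.continuous_ofReal.tendsto' 1 1 (by simp)).mono_left nhdsWithin_le_nhds
    · filter_upwards [self_mem_nhdsWithin] with t ht
      have : t ≠ 1 := ne_of_gt ht
      simpa using this
  refine ht.frequently (Eventually.frequently ?_)
  filter_upwards [self_mem_nhdsWithin] with t ht
  have ht : 0 < t := lt_trans one_pos ht
  rw [Complex.integral_cpow_mul_exp_neg_mul_Ioi (a := s) (by simpa) ht, mul_comm, Complex.cpow_neg,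
    one_div, Complex.inv_cpow]
  rw [Complex.arg_ofReal_of_nonneg ht.le]; exact Real.pi_pos.ne

noncomputable def zt (w : ℝ) : ℂ := 1 + 2 * Real.pi * w * Complex.I

lemma zt_re (w : ℝ) : (zt w).re = 1 := by simp [zt]
lemma zt_ne (w : ℝ) : zt w ≠ 0 := by
  intro h; have := zt_re w; rw [h] at this; simp at this
lemma zt_slit (w : ℝ) : zt w ∈ Complex.slitPlane := by
  left; rw [zt_re]; norm_num
lemma zt_cont : Continuous zt := by unfold zt; fun_prop
lemma zt_norm (w : ℝ) : (1 + ‖w‖^2) ^ ((1:ℝ)/2) ≤ ‖zt w‖ := by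
  rw [← Real.sqrt_eq_rpow, Complex.norm_def]
  apply Real.sqrt_le_sqrt
  rw [Complex.normSq_apply]
  simp [zt]
  nlinarith [Real.pi_gt_three, sq_nonneg w, mul_nonneg (sq_nonneg w) (sub_nonneg.2 Real.pi_gt_three.le), mul_nonneg (sq_nonneg w) (sq_nonneg (Real.pi - 3))]
lemma zt_norm_one (w : ℝ) : 1 ≤ ‖zt w‖ := by
  have := Complex.re_le_norm (zt w)
  rwa [zt_re] at this

lemma cpow_cont (s : ℂ) : Continuous (fun w => zt w ^ s) := by
  refine continuous_iff_continuousAt.2 fun w => ?_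
  exact (zt_cont.continuousAt).cpow continuousAt_const (zt_slit w)

lemma cpow_int (s : ℝ) (hs : 1 < s) : Integrable (fun w => zt w ^ (-(s:ℂ))) := by
  have h := integrable_rpow_neg_one_add_norm_sq (E := ℝ) (μ := volume) (r := s) (by simpa using hs)
  refine h.mono' (cpow_cont _).aestronglyMeasurable (Eventually.of_forall fun w => ?_)
  have : -(s:ℂ) = ((-s : ℝ) : ℂ) := by simp
  rw [this, Complex.norm_cpow_real]
  have h0 : 0 < 1 + ‖w‖^2 := by positivity
  calc ‖zt w‖ ^ (-s) ≤ ((1 + ‖w‖^2) ^ ((1:ℝ)/2)) ^ (-s) :=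
        Real.rpow_le_rpow_of_nonpos (by positivity) (zt_norm w) (by linarith)
    _ = _ := by rw [← Real.rpow_mul h0.le]; congr 1; ring

noncomputable def gg (s v : ℝ) : ℂ := (((max v 0) ^ (s-1) * Real.exp (-v) : ℝ) : ℂ)

lemma gg_cont (s : ℝ) (hs : 1 < s) : Continuous (gg s) := by
  unfold gg
  refine Complex.continuous_ofReal.comp (Continuous.mul ?_ (by fun_prop))
  exact (by fun_prop : Continuous fun v : ℝ => max v 0).rpow_const (fun x => Or.inr (by linarith))

lemma gg_zero (s : ℝ) (hs : 1 < s) (v : ℝ) (hv : v ∉ Ioi (0:ℝ)) : gg s v = 0 := by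
  have : v ≤ 0 := by simpa using hv
  simp [gg, max_eq_right this, Real.zero_rpow (by linarith : s - 1 ≠ 0)]

lemma gg_int (s : ℝ) (hs : 1 < s) : Integrable (gg s) := by
  have h : IntegrableOn (gg s) (Ioi 0) := by
    have := (Real.GammaIntegral_convergent (s := s) (by linarith)).ofReal (𝕜 := ℂ)
    refine (integrable_congr ?_).1 this
    filter_upwards [ae_restrict_mem measurableSet_Ioi] with v hv
    simp only [gg, max_eq_left (le_of_lt (mem_Ioi.1 hv))]
    rw [mul_comm]; rfl
  exact (integrableOn_iff_integrable_of_support_subset (by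
    intro v hv; by_contra h'; exact hv (gg_zero s hs v h'))).1 h

open FourierTransform in
lemma gg_fourier (s : ℝ) (hs : 1 < s) (w : ℝ) : 𝓕 (gg s) w = Complex.Gamma s * zt w ^ (-(s:ℂ)) := by
  rw [Real.fourier_real_eq_integral_exp_smul]
  rw [← setIntegral_eq_integral_of_forall_compl_eq_zero (s := Ioi 0)
    (fun v hv => by rw [gg_zero s hs v hv, smul_zero])]
  have := laplace_pow s (by linarith) (zt w) (by rw [zt_re]; norm_num)
  rw [← this]
  refine setIntegral_congr_fun measurableSet_Ioi fun v hv => ?_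
  simp only [gg, max_eq_left (le_of_lt (mem_Ioi.1 hv)), smul_eq_mul]
  push_cast
  rw [Complex.ofReal_cpow (le_of_lt (mem_Ioi.1 hv))]
  push_cast
  rw [mul_left_comm, ← Complex.exp_add]
  congr 2
  simp [zt]; ring

open FourierTransform in
lemma bromwich (s : ℝ) (hs : 1 < s) :
    ∫ w, Complex.exp (zt w) * zt w ^ (-(s:ℂ)) = 1 / Complex.Gamma s := by
  have hF : 𝓕 (gg s) = fun w => Complex.Gamma s * zt w ^ (-(s:ℂ)) := funext (gg_fourier s hs)
  have h := congrFun ((gg_cont s hs).fourierInv_fourier_eq (gg_int s hs)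
    (by rw [hF]; exact (cpow_int s hs).const_mul _)) 1
  rw [Real.fourierInv_eq', hF] at h
  have hG : Complex.Gamma s ≠ 0 := Complex.Gamma_ne_zero_of_re_pos (by simp; linarith)
  rw [eq_div_iff hG, ← integral_mul_const]
  have h2 : gg s 1 = Complex.exp (-1) := by simp [gg]
  rw [h2] at h
  have h3 : Complex.exp 1 * Complex.exp (-1) = 1 := by rw [← Complex.exp_add]; simp
  rw [← h3, ← h, ← integral_const_mul]
  congr 1; ext w
  simp only [smul_eq_mul]
  rw [← mul_assoc, ← Complex.exp_add]
  have : zt w = 1 + ((2 * Real.pi * inner ℝ w (1:ℝ) : ℝ) : ℂ) * Complex.I := by simp [zt]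
  rw [← this]; ring

lemma norm_inv_le (u x : ℂ) (d : ℝ) (hu : 0 ≤ u.re) (hd : 0 < d) (hx : d ≤ x.re) : ‖(u + x)⁻¹‖ ≤ d⁻¹ := by
  rw [norm_inv]
  have : d ≤ ‖u + x‖ := by
    refine le_trans ?_ (Complex.re_le_norm _)
    simp; linarith
  gcongr

lemma ux_ne (u x : ℂ) (hu : 0 ≤ u.re) (hx : 0 < x.re) : u + x ≠ 0 := by
  intro h
  have := congrArg Complex.re h
  simp at this; linarith

lemma stieltjes_meas (m u : ℝ → ℂ) (hm : Integrable m) (hu : Continuous u) (k : ℕ) (x : ℂ) :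
    AEStronglyMeasurable (fun w => m w * ((u w + x)⁻¹)^k) volume := by
  refine hm.1.mul ?_
  exact ((hu.measurable.add_const x).inv.pow_const k).aestronglyMeasurable

lemma stieltjes_int (m u : ℝ → ℂ) (hm : Integrable m) (hu : Continuous u) (hre : ∀ w, 0 ≤ (u w).re)
    (k : ℕ) (x : ℂ) (hx : 0 < x.re) : Integrable (fun w => m w * ((u w + x)⁻¹)^k) := by
  refine (hm.norm.mul_const ((x.re)⁻¹^k)).mono' (stieltjes_meas m u hm hu k x) (Eventually.of_forall fun w => ?_)
  rw [norm_mul, norm_pow]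
  gcongr
  exact norm_inv_le _ _ _ (hre w) hx le_rfl

lemma stieltjes_diff (m u : ℝ → ℂ) (hm : Integrable m) (hu : Continuous u) (hre : ∀ w, 0 ≤ (u w).re)
    (k : ℕ) : DifferentiableOn ℂ (fun x : ℂ => ∫ w, m w * ((u w + x)⁻¹)^k) {z : ℂ | 0 < z.re} := by
  intro x hx
  have hx : 0 < x.re := hx
  refine (DifferentiableAt.differentiableWithinAt ?_)
  refine (hasDerivAt_integral_of_dominated_loc_of_deriv_le (rhp_nhds x hx)
    (F := fun (z : ℂ) (w : ℝ) => m w * ((u w + z)⁻¹)^k)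
    (F' := fun (z : ℂ) (w : ℝ) => -k * (m w * ((u w + z)⁻¹)^(k+1)))
    (bound := fun w => k * (‖m w‖ * ((x.re/2)⁻¹)^(k+1)))
    (Eventually.of_forall fun z => stieltjes_meas m u hm hu _ _) (stieltjes_int m u hm hu hre k x hx)
      ((stieltjes_meas m u hm hu _ _).const_mul _) ?_ ((hm.norm.mul_const _).const_mul _) ?_).2.differentiableAt
  · filter_upwards with w z hz
    have hz : x.re / 2 < z.re := hz
    rw [norm_mul, norm_mul, norm_pow, norm_neg, Complex.norm_natCast]
    gcongr
    exact norm_inv_le _ _ _ (hre w) (by linarith) hz.le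
  · filter_upwards with w z hz
    have hz : x.re / 2 < z.re := hz
    have hne := ux_ne (u w) z (hre w) (by linarith)
    have h : HasDerivAt (fun z : ℂ => u w + z) 1 z := (hasDerivAt_id z).const_add _
    convert! (((h.inv hne).pow k).const_mul (m w)) using 1
    rcases k with _ | k
    · simp
    · simp; field_simp; ring

lemma stieltjes_lim (m u : ℝ → ℂ) (hm : Integrable m) (hu : Continuous u) (hre : ∀ w, 0 ≤ (u w).re)
    (k : ℕ) : Tendsto (fun x : ℝ => (x:ℂ)^k * ∫ w, m w * ((u w + x)⁻¹)^k) atTop (nhds (∫ w, m w)) := by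
  simp_rw [← integral_const_mul]
  refine tendsto_integral_filter_of_dominated_convergence (fun w => ‖m w‖)
    (Eventually.of_forall fun x => (stieltjes_meas m u hm hu _ _).const_mul _) ?_ hm.norm ?_
  · filter_upwards [eventually_gt_atTop 0] with x hx
    filter_upwards with w
    have h := norm_inv_le (u w) x x (hre w) hx (by simp)
    rw [norm_mul, norm_mul, norm_pow, norm_pow, mul_left_comm, ← mul_pow]
    have h2 : ‖(x:ℂ)‖ * ‖(u w + x)⁻¹‖ ≤ 1 := by
      rw [Complex.norm_real, Real.norm_of_nonneg hx.le]
      calc x * ‖(u w + x)⁻¹‖ ≤ x * x⁻¹ := by gcongr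
        _ = 1 := mul_inv_cancel₀ hx.ne'
    exact mul_le_of_le_one_right (norm_nonneg _) (pow_le_one₀ (by positivity) h2)
  · filter_upwards with w
    have h1 : Tendsto (fun x : ℝ => (x:ℂ) * (u w + x)⁻¹) atTop (nhds 1) := by
      have h0 : Tendsto (fun x : ℝ => (u w * ((x⁻¹ : ℝ) : ℂ) + 1)⁻¹) atTop (nhds ((u w * ((0:ℝ):ℂ) + 1)⁻¹)) := by
        refine Tendsto.inv₀ ?_ (by simp)
        exact (((Complex.continuous_ofReal.tendsto 0).comp tendsto_inv_atTop_zero).const_mul _).add_const _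
      simp only [Complex.ofReal_zero, mul_zero, zero_add, inv_one] at h0
      refine h0.congr' ?_
      filter_upwards [eventually_gt_atTop 0] with x hx
      have hx' : (x:ℂ) ≠ 0 := by exact_mod_cast hx.ne'
      have := ux_ne (u w) x (hre w) (by simpa)
      have e : u w * ((x⁻¹ : ℝ) : ℂ) + 1 = (u w + x) * (x:ℂ)⁻¹ := by push_cast; field_simp
      rw [e, mul_inv, inv_inv, mul_comm]
    have h2 := (h1.pow k).const_mul (m w)
    simp only [one_pow, mul_one] at h2
    refine h2.congr fun x => ?_
    rw [mul_pow]; ring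

lemma gamma_growth (s R : ℝ) (hs : 1 ≤ s) (hR : 0 < R) : R ^ (s-1) * Real.exp (-R) ≤ Real.Gamma s := by
  rw [Real.Gamma_eq_integral (by linarith)]
  have hc := Real.GammaIntegral_convergent (s := s) (by linarith)
  calc R ^ (s-1) * Real.exp (-R) = ∫ x in Ioi R, R ^ (s-1) * Real.exp (-x) := by
        rw [integral_const_mul, integral_exp_neg_Ioi]
    _ ≤ ∫ x in Ioi R, Real.exp (-x) * x ^ (s-1) := by
        refine setIntegral_mono_on ((integrableOn_exp_neg_Ioi R).const_mul _) 
          (hc.mono_set (Ioi_subset_Ioi hR.le)) measurableSet_Ioi fun x hx => ?_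
        have hx : R < x := hx
        rw [mul_comm]
        have := Real.rpow_le_rpow hR.le hx.le (by linarith : 0 ≤ s - 1)
        gcongr
    _ ≤ _ := by
        refine setIntegral_mono_set hc ?_ (Ioi_subset_Ioi hR.le).eventuallyLE
        filter_upwards [ae_restrict_mem measurableSet_Ioi] with x hx
        have hx : 0 < x := hx
        simp only [Pi.zero_apply]
        positivity

lemma ml_summable (β M : ℝ) (hβ : 0 < β) (hM : 0 < M) :
    Summable (fun n : ℕ => M ^ n / Real.Gamma (n * β + β)) := by
  set R : ℝ := (2 * M) ^ (1/β) with hRdef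
  have hR : 0 < R := by positivity
  have hRβ : R ^ β = 2 * M := by
    rw [hRdef, ← Real.rpow_mul (by positivity)]; field_simp; simp
  have hs : Summable (fun n : ℕ => (Real.exp R * R ^ (1 - β)) * (1/2 : ℝ)^n) :=
    (summable_geometric_of_lt_one (by norm_num) (by norm_num)).mul_left _
  refine Summable.of_norm_bounded_eventually_nat hs ?_
  have ht : Tendsto (fun n : ℕ => (n:ℝ) * β + β) atTop atTop :=
    tendsto_atTop_add_const_right _ _ (tendsto_natCast_atTop_atTop.atTop_mul_const hβ)
  filter_upwards [ht.eventually_ge_atTop 1] with n hn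
  have hg := gamma_growth _ R hn hR
  have hgp : 0 < R ^ (n * β + β - 1) * Real.exp (-R) := by positivity
  rw [Real.norm_of_nonneg (div_nonneg (by positivity) (hgp.le.trans hg))]
  calc M ^ n / Real.Gamma (n * β + β) ≤ M ^ n / (R ^ (n * β + β - 1) * Real.exp (-R)) := by gcongr
    _ = _ := by
      have e1 : R ^ (n * β + β - 1) = (2 * M)^n * (R ^ (1 - β))⁻¹ := by
        rw [← hRβ, ← Real.rpow_neg hR.le, ← Real.rpow_natCast, ← Real.rpow_mul hR.le, ← Real.rpow_add hR]
        congr 1; ring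
      rw [e1, Real.exp_neg, mul_pow, one_div, inv_pow]
      field_simp

lemma ml_diff (β : ℝ) (hβ : 0 < β) :
    Differentiable ℂ (fun z : ℂ => ∑' n : ℕ, (-z)^n / (Real.Gamma (n * β + β) : ℂ)) := by
  intro z
  have h := Complex.differentiableOn_tsum_of_summable_norm (U := Metric.ball 0 (‖z‖+1))
    (F := fun (n : ℕ) (z : ℂ) => (-z)^n / (Real.Gamma (n * β + β) : ℂ))
    (ml_summable β (‖z‖+1) hβ (by positivity)) (fun i => by fun_prop) Metric.isOpen_ball ?_
  · exact h.differentiableAt (Metric.isOpen_ball.mem_nhds (by simp))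
  · intro n w hw
    have hw : ‖w‖ < ‖z‖ + 1 := by simpa using hw
    have hg : 0 < Real.Gamma (n * β + β) := Real.Gamma_pos_of_pos (by positivity)
    rw [norm_div, norm_pow, norm_neg, Complex.norm_real, Real.norm_of_nonneg hg.le]
    gcongr

lemma u_re (β : ℝ) (hβ : β ∈ Set.Ioo (0:ℝ) 1) (w : ℝ) : 0 ≤ (zt w ^ (β:ℂ)).re := by
  rw [Complex.cpow_def_of_ne_zero (zt_ne w), Complex.exp_re]
  refine mul_nonneg (Real.exp_pos _).le (Real.cos_nonneg_of_mem_Icc ?_)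
  have h : |(zt w).arg| ≤ Real.pi / 2 := Complex.abs_arg_le_pi_div_two_iff.2 (by rw [zt_re]; norm_num)
  have e : (Complex.log (zt w) * (β:ℂ)).im = (zt w).arg * β := by simp [Complex.mul_im, Complex.log_im]
  rw [e]
  refine abs_le.1 ?_
  rw [abs_mul, abs_of_pos hβ.1]
  calc |(zt w).arg| * β ≤ Real.pi / 2 * 1 := by
        exact mul_le_mul h hβ.2.le hβ.1.le (by positivity)
    _ = _ := mul_one _

lemma u_norm (β : ℝ) (hβ : β ∈ Set.Ioo (0:ℝ) 1) (w : ℝ) : 1 ≤ ‖zt w ^ (β:ℂ)‖ := by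
  rw [Complex.norm_cpow_real]
  exact Real.one_le_rpow (zt_norm_one w) hβ.1.le

lemma m_int (s : ℝ) (hs : 1 < s) : Integrable (fun w => Complex.exp (zt w) * zt w ^ (-(s:ℂ))) := by
  refine (cpow_int s hs).bdd_mul (c := Real.exp 1) ((Complex.continuous_exp.comp zt_cont).aestronglyMeasurable) ?_
  filter_upwards with w
  rw [Complex.norm_exp, zt_re]

noncomputable def mm (β : ℝ) (w : ℝ) : ℂ := Complex.exp (zt w) * zt w ^ (-((2 - β : ℝ):ℂ))

lemma zt_split (β : ℝ) (n : ℕ) (w : ℝ) :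
    zt w ^ (-((n * β + β + 2 : ℝ):ℂ)) = zt w ^ (-((2 - β : ℝ):ℂ)) * ((zt w ^ (β:ℂ))⁻¹)^(n+2) := by
  have h0 : zt w ^ (β:ℂ) ≠ 0 := by
    rw [Complex.cpow_def_of_ne_zero (zt_ne w)]; exact Complex.exp_ne_zero _
  rw [inv_pow, eq_mul_inv_iff_mul_eq₀ (pow_ne_zero _ h0), ← Complex.cpow_mul_nat, ← Complex.cpow_add _ _ (zt_ne w)]
  congr 1
  push_cast; ring

noncomputable def cc (β : ℝ) (n : ℕ) : ℂ :=
  (β:ℂ) * (1 - β) * ((n + 1).choose 1 : ℕ) + 2 * (β:ℂ)^2 * ((n + 2).choose 2 : ℕ)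

lemma cc_eq (β : ℝ) (n : ℕ) : cc β n = ((n:ℂ) * β + β) * (n * β + β + 1) := by
  have h : (((n + 2).choose 2 : ℕ) : ℂ) = ((n:ℂ) + 2) * (n + 1) / 2 := by
    rw [Nat.cast_choose_two]; push_cast; ring
  rw [cc, h]
  simp
  ring

lemma cc_sum (β : ℝ) (r : ℂ) (hr : ‖r‖ < 1) :
    HasSum (fun n => cc β n * r ^ n) ((β:ℂ) * (1 - β) * (1 / (1 - r)^2) + 2 * (β:ℂ)^2 * (1 / (1 - r)^3)) := by
  have h1 := (hasSum_choose_mul_geometric_of_norm_lt_one 1 hr).mul_left ((β:ℂ) * (1 - β))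
  have h2 := (hasSum_choose_mul_geometric_of_norm_lt_one 2 hr).mul_left (2 * (β:ℂ)^2)
  convert! h1.add h2 using 1
  ext n
  rw [cc]; ring

noncomputable def GG (β : ℝ) (x : ℂ) : ℂ :=
  (β:ℂ) * (1 + β) * (∫ w, mm β w * ((zt w ^ (β:ℂ) + x)⁻¹)^2)
    - 2 * (β:ℂ)^2 * (x * ∫ w, mm β w * ((zt w ^ (β:ℂ) + x)⁻¹)^3)

lemma mm_int (β : ℝ) (hβ : β ∈ Set.Ioo (0:ℝ) 1) : Integrable (mm β) := m_int _ (by linarith [hβ.2])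

noncomputable def FF (β : ℝ) (x : ℂ) (n : ℕ) (w : ℝ) : ℂ :=
  cc β n * (-x)^n * (Complex.exp (zt w) * zt w ^ (-((n * β + β + 2 : ℝ):ℂ)))

lemma FF_int (β : ℝ) (hβ : β ∈ Set.Ioo (0:ℝ) 1) (x : ℂ) (n : ℕ) : Integrable (FF β x n) := by
  have := hβ.1
  exact (m_int _ (by nlinarith [(Nat.cast_nonneg n : (0:ℝ) ≤ n)])).const_mul _

lemma FF_integral (β : ℝ) (hβ : β ∈ Set.Ioo (0:ℝ) 1) (x : ℂ) (n : ℕ) :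
    ∫ w, FF β x n w = (-x)^n / (Real.Gamma (n * β + β) : ℂ) := by
  have hb := hβ.1
  have hp : 0 < n * β + β := by positivity
  unfold FF
  rw [integral_const_mul, bromwich _ (by linarith), Complex.Gamma_ofReal, cc_eq]
  have hg : (Real.Gamma (n * β + β) : ℂ) ≠ 0 := by
    exact_mod_cast (Real.Gamma_pos_of_pos hp).ne'
  have e : Real.Gamma (n * β + β + 2) = (n * β + β + 1) * ((n * β + β) * Real.Gamma (n * β + β)) := by
    rw [← Real.Gamma_add_one hp.ne', ← Real.Gamma_add_one (by linarith)]; congr 1; ring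
  rw [e]
  have h1 : ((n:ℂ) * β + β) ≠ 0 := by exact_mod_cast hp.ne'
  have h2 : ((n:ℂ) * β + β + 1) ≠ 0 := by exact_mod_cast (by linarith : 0 < n * β + β + 1).ne'
  push_cast
  rw [mul_one_div, div_eq_div_iff (mul_ne_zero h2 (mul_ne_zero h1 hg)) hg]
  ring

lemma FF_norm (β : ℝ) (hβ : β ∈ Set.Ioo (0:ℝ) 1) (x : ℂ) (n : ℕ) (w : ℝ) :
    ‖FF β x n w‖ ≤ ‖cc β n * x^n‖ * ‖mm β w‖ := by
  unfold FF
  rw [zt_split, ← mul_assoc (Complex.exp _), norm_mul, norm_mul (_ * _) (_ ^ _)]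
  have h1 : ‖cc β n * (-x)^n‖ = ‖cc β n * x^n‖ := by simp
  rw [h1]
  refine mul_le_mul_of_nonneg_left ?_ (norm_nonneg _)
  refine mul_le_of_le_one_right (norm_nonneg _) ?_
  rw [norm_pow, norm_inv]
  exact pow_le_one₀ (by positivity) (inv_le_one_of_one_le₀ (u_norm β hβ w))

lemma FF_hasSum (β : ℝ) (hβ : β ∈ Set.Ioo (0:ℝ) 1) (x : ℂ) (hx : ‖x‖ < 1) (w : ℝ) :
    HasSum (fun n => FF β x n w) ((β:ℂ) * (1 + β) * (mm β w * ((zt w ^ (β:ℂ) + x)⁻¹)^2)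
    - 2 * (β:ℂ)^2 * (x * (mm β w * ((zt w ^ (β:ℂ) + x)⁻¹)^3))) := by
  have hu := u_norm β hβ w
  set u := zt w ^ (β:ℂ) with hudef
  have hu0 : u ≠ 0 := by intro h; rw [h] at hu; simp at hu; linarith
  have hux : u + x ≠ 0 := by
    intro h
    have : u = -x := eq_neg_of_add_eq_zero_left h
    rw [this, norm_neg] at hu; linarith
  have hr : ‖-x * u⁻¹‖ < 1 := by
    rw [norm_mul, norm_neg, norm_inv]
    exact lt_of_le_of_lt (mul_le_of_le_one_right (norm_nonneg _) (inv_le_one_of_one_le₀ hu)) hx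
  have h := (cc_sum β _ hr).mul_left (mm β w * u⁻¹^2)
  have e : 1 - -x * u⁻¹ = (u + x) * u⁻¹ := by field_simp; ring
  convert! h using 1
  · ext n
    rw [FF, zt_split, mm, ← hudef, mul_pow, pow_add]
    ring
  · rw [e]
    field_simp
    ring

lemma GG_hasSum (β : ℝ) (hβ : β ∈ Set.Ioo (0:ℝ) 1) (x : ℂ) (hx : ‖x‖ < 1) (hx0 : 0 < x.re) :
    ∑' n : ℕ, (-x)^n / (Real.Gamma (n * β + β) : ℂ) = GG β x := by
  have hs : Summable fun n => ∫ w, ‖FF β x n w‖ := by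
    refine Summable.of_nonneg_of_le (fun n => integral_nonneg fun w => norm_nonneg _) (fun n => ?_)
      ((cc_sum β x hx).summable.norm.mul_right (∫ w, ‖mm β w‖))
    rw [← integral_const_mul]
    exact integral_mono (FF_int β hβ x n).norm ((mm_int β hβ).norm.const_mul _) (FF_norm β hβ x n)
  have h := hasSum_integral_of_summable_integral_norm (FF_int β hβ x) hs
  simp_rw [FF_integral β hβ x, fun w => (FF_hasSum β hβ x hx w).tsum_eq] at h
  rw [h.tsum_eq, GG]
  have i2 := stieltjes_int (mm β) _ (mm_int β hβ) (cpow_cont β) (u_re β hβ) 2 x hx0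
  have i3 := stieltjes_int (mm β) _ (mm_int β hβ) (cpow_cont β) (u_re β hβ) 3 x hx0
  rw [integral_sub (i2.const_mul _) ((i3.const_mul _).const_mul _), integral_const_mul, integral_const_mul,
    integral_const_mul]

lemma GG_eq (β : ℝ) (hβ : β ∈ Set.Ioo (0:ℝ) 1) (x : ℂ) (hx0 : 0 < x.re) :
    ∑' n : ℕ, (-x)^n / (Real.Gamma (n * β + β) : ℂ) = GG β x := by
  have h1 := ((ml_diff β hβ.1).differentiableOn (s := {z : ℂ | 0 < z.re})).analyticOnNhd rhp_open
  have h2 : AnalyticOnNhd ℂ (GG β) {z : ℂ | 0 < z.re} := by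
    refine DifferentiableOn.analyticOnNhd ?_ rhp_open
    have d2 := stieltjes_diff (mm β) _ (mm_int β hβ) (cpow_cont β) (u_re β hβ) 2
    have d3 := stieltjes_diff (mm β) _ (mm_int β hβ) (cpow_cont β) (u_re β hβ) 3
    exact (d2.const_mul _).sub ((differentiableOn_id.mul d3).const_mul _)
  refine h1.eqOn_of_preconnected_of_eventuallyEq h2 rhp_pre (z₀ := 1/2) (by simp) ?_ hx0
  filter_upwards [rhp_open.mem_nhds (by simp : (1/2 : ℂ) ∈ {z : ℂ | 0 < z.re}),
    Metric.isOpen_ball.mem_nhds (by norm_num : (1/2 : ℂ) ∈ Metric.ball (0:ℂ) 1)] with z hz hz'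
  exact GG_hasSum β hβ z (by simpa using hz') hz

lemma GG_lim (β : ℝ) (hβ : β ∈ Set.Ioo (0:ℝ) 1) :
    Tendsto (fun x : ℝ => (x:ℂ)^2 * GG β x) atTop (nhds ((β / Real.Gamma (1 - β) : ℝ) : ℂ)) := by
  have l2 := stieltjes_lim (mm β) _ (mm_int β hβ) (cpow_cont β) (u_re β hβ) 2
  have l3 := stieltjes_lim (mm β) _ (mm_int β hβ) (cpow_cont β) (u_re β hβ) 3
  have h := (l2.const_mul ((β:ℂ) * (1 + β))).sub (l3.const_mul (2 * (β:ℂ)^2))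
  have hi : ∫ w, mm β w = 1 / Complex.Gamma ((2 - β : ℝ) : ℂ) := bromwich _ (by linarith [hβ.2])
  have hp : 0 < 1 - β := by linarith [hβ.2]
  have e : Real.Gamma (2 - β) = (1 - β) * Real.Gamma (1 - β) := by
    rw [← Real.Gamma_add_one hp.ne']; congr 1; ring
  have hg : (Real.Gamma (1 - β) : ℂ) ≠ 0 := by
    exact_mod_cast (Real.Gamma_pos_of_pos hp).ne'
  have hp' : (1:ℂ) - β ≠ 0 := by exact_mod_cast hp.ne'
  rw [hi, Complex.Gamma_ofReal, e] at h
  have e2 : ((β / Real.Gamma (1 - β) : ℝ) : ℂ) = (β:ℂ) * (1 + β) * (1 / (((1 - β) * Real.Gamma (1 - β) : ℝ) : ℂ))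
     - 2 * (β:ℂ)^2 * (1 / (((1 - β) * Real.Gamma (1 - β) : ℝ) : ℂ)) := by
    push_cast
    field_simp
    ring
  rw [e2]
  refine h.congr fun x => ?_
  rw [GG]; ring

/-- For `β ∈ (0,1)`, the Mittag-Leffler density decays as a power law with
exponent `β + 1`: `t^{β+1} f_β(t) → β/Γ(1-β)` as `t → ∞`. -/
theorem mittagLeffler_density_powerlaw (β : ℝ) (hβ : β ∈ Set.Ioo (0:ℝ) 1) :
    Filter.Tendsto (fun t : ℝ => t ^ (β + 1) * fML β t) Filter.atTop
      (nhds (β / Real.Gamma (1 - β))) := by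
  have h := (Complex.continuous_re.tendsto _).comp
    ((GG_lim β hβ).comp (tendsto_rpow_atTop hβ.1))
  rw [Complex.ofReal_re] at h
  refine h.congr' ?_
  filter_upwards [eventually_gt_atTop 0] with t ht
  have htb : 0 < t ^ β := Real.rpow_pos_of_pos ht β
  simp only [Function.comp_apply]
  rw [← GG_eq β hβ _ (by simpa using htb)]
  have e : (∑' n : ℕ, (-((t ^ β : ℝ) : ℂ))^n / (Real.Gamma (n * β + β) : ℂ))
      = ((ML2 β β (-(t ^ β)) : ℝ) : ℂ) := by
    rw [ML2, Complex.ofReal_tsum]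
    push_cast
    rfl
  rw [e, ← Complex.ofReal_pow, ← Complex.ofReal_mul, Complex.ofReal_re, fML, ← mul_assoc,
    ← Real.rpow_add ht, ← Real.rpow_natCast, ← Real.rpow_mul ht.le]
  congr 2
  push_cast; ring
end

section
/- Let β ∈ (0,1). The function g(t) = E_β(-t^β) solves the fractional relaxation equation with the Caputo derivative of order β: for every t > 0, (1/Γ(1-β)) · (d/dt) ∫_0^t g(τ) (t-τ)^{-β} dτ − t^{-β}/Γ(1-β) = −g(t) (the Caputo derivative with initial condition g(0⁺) = 1 equals −g). -/
open MeasureTheory Set Filter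

lemma aux_gamma_lb (A : ℝ) (hA : 0 < A) (s : ℝ) (hs : 1 ≤ s) :
    A ^ (s - 1) * Real.exp (-A) ≤ Real.Gamma s := by
  have hs0 : 0 < s := by linarith
  rw [Real.Gamma_eq_integral hs0, ← integral_exp_neg_Ioi A, ← integral_const_mul]
  have hint := Real.GammaIntegral_convergent hs0
  have hsub : Ioi A ⊆ Ioi (0:ℝ) := Ioi_subset_Ioi hA.le
  calc ∫ x in Ioi A, A ^ (s - 1) * Real.exp (-x)
      ≤ ∫ x in Ioi A, Real.exp (-x) * x ^ (s - 1) := by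
        refine setIntegral_mono_on ?_ (hint.mono_set hsub) measurableSet_Ioi ?_
        · have := exp_neg_integrableOn_Ioi A (b := 1) one_pos
          simp only [neg_mul, one_mul] at this
          exact this.const_mul _
        · intro x hx
          rw [mul_comm]
          have hx' : A < x := hx
          exact mul_le_mul_of_nonneg_left
            (Real.rpow_le_rpow hA.le hx'.le (by linarith)) (Real.exp_pos _).le
    _ ≤ ∫ x in Ioi 0, Real.exp (-x) * x ^ (s - 1) := by
        refine setIntegral_mono_set hint ?_ hsub.eventuallyLE
        filter_upwards [ae_restrict_mem measurableSet_Ioi] with x hx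
        have hx' : 0 < x := hx
        simp only [Pi.zero_apply]
        positivity

lemma aux_summable (β δ z : ℝ) (hβ : 0 < β) (hδ : 1 ≤ δ) :
    Summable (fun n : ℕ => z ^ n / Real.Gamma (n * β + δ)) := by
  set B : ℝ := 2 * |z| + 1 with hB
  have hBpos : 0 < B := by positivity
  set A : ℝ := B ^ (1 / β) with hAdef
  have hA : 0 < A := Real.rpow_pos_of_pos hBpos _
  have hAB : A ^ β = B := by
    rw [hAdef, ← Real.rpow_mul hBpos.le, one_div, inv_mul_cancel₀ hβ.ne', Real.rpow_one]
  have hr : |z| / B < 1 := by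
    rw [div_lt_one hBpos]; have := abs_nonneg z; linarith
  have hg : Summable (fun n : ℕ => (|z| / B) ^ n * (A ^ (δ - 1) * Real.exp (-A))⁻¹) :=
    (summable_geometric_of_lt_one (by positivity) hr).mul_right _
  refine Summable.of_norm_bounded hg (fun n => ?_)
  have hn : (0:ℝ) ≤ n * β := by positivity
  have hG : 0 < Real.Gamma (n * β + δ) := Real.Gamma_pos_of_pos (by linarith)
  have h1 := aux_gamma_lb A hA (n * β + δ) (by linarith)
  have h2 : A ^ (n * β + δ - 1) = B ^ n * A ^ (δ - 1) := by
    rw [show (n * β + δ - 1 : ℝ) = β * n + (δ - 1) by ring, Real.rpow_add hA, Real.rpow_mul hA.le,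
      hAB, Real.rpow_natCast]
  rw [h2] at h1
  rw [norm_div, norm_pow, Real.norm_eq_abs, Real.norm_eq_abs, abs_of_pos hG, div_pow,
    div_mul_eq_mul_div, ← div_eq_mul_inv, div_div]
  apply div_le_div_of_nonneg_left (by positivity) (by positivity)
  calc _ = B ^ n * A ^ (δ - 1) * Real.exp (-A) := by ring
    _ ≤ _ := h1

lemma aux_beta (a b x : ℝ) (ha : 0 ≤ a) (hb : b < 1) (hx : 0 < x) :
    ∫ τ in (0:ℝ)..x, τ ^ a * (x - τ) ^ (-b) =
      x ^ (a + 1 - b) * (Real.Gamma (a + 1) * Real.Gamma (1 - b) / Real.Gamma (a + 2 - b)) := by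
  have h := Complex.betaIntegral_scaled ((a + 1 : ℝ) : ℂ) ((1 - b : ℝ) : ℂ) hx
  have hB := Complex.betaIntegral_eq_Gamma_mul_div ((a + 1 : ℝ) : ℂ) ((1 - b : ℝ) : ℂ)
    (by simp; linarith) (by simp; linarith)
  rw [hB] at h
  have hl : ∫ τ in (0:ℝ)..x, (τ : ℂ) ^ (((a + 1 : ℝ) : ℂ) - 1) *
      ((x : ℂ) - τ) ^ (((1 - b : ℝ) : ℂ) - 1) =
      ((∫ τ in (0:ℝ)..x, τ ^ a * (x - τ) ^ (-b) : ℝ) : ℂ) := by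
    rw [← intervalIntegral.integral_ofReal]
    refine intervalIntegral.integral_congr (fun τ hτ => ?_)
    rw [uIcc_of_le hx.le] at hτ
    have e1 : (((a + 1 : ℝ) : ℂ) - 1) = (a : ℂ) := by push_cast; ring
    have e2 : (((1 - b : ℝ) : ℂ) - 1) = ((-b : ℝ) : ℂ) := by push_cast; ring
    simp only [e1, e2]
    rw [Complex.ofReal_mul, Complex.ofReal_cpow hτ.1, Complex.ofReal_cpow (sub_nonneg.2 hτ.2),
      Complex.ofReal_sub]
  rw [hl] at h
  have e3 : ((a + 1 : ℝ) : ℂ) + ((1 - b : ℝ) : ℂ) = ((a + 2 - b : ℝ) : ℂ) := by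
    push_cast; ring
  have e4 : ((a + 2 - b : ℝ) : ℂ) - 1 = ((a + 1 - b : ℝ) : ℂ) := by push_cast; ring
  rw [e3, e4, ← Complex.ofReal_cpow hx.le, Complex.Gamma_ofReal, Complex.Gamma_ofReal,
    Complex.Gamma_ofReal] at h
  exact_mod_cast h

lemma aux_integrable (a b x : ℝ) (ha : 0 ≤ a) (hb : b < 1) :
    IntervalIntegrable (fun τ : ℝ => τ ^ a * (x - τ) ^ (-b)) volume 0 x := by
  have h1 : IntervalIntegrable (fun τ : ℝ => (x - τ) ^ (-b)) volume 0 x := by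
    have := (intervalIntegral.intervalIntegrable_rpow' (a := 0) (b := x) (r := -b)
      (by linarith)).comp_sub_left x
    simp only [sub_zero, sub_self] at this
    exact this.symm
  exact h1.continuousOn_mul (Real.continuous_rpow_const ha).continuousOn

lemma aux_pow (β : ℝ) (τ : ℝ) (hτ : 0 ≤ τ) (n : ℕ) :
    (-(τ ^ β)) ^ n = (-1) ^ n * τ ^ ((n:ℝ) * β) := by
  rw [neg_pow, mul_comm (n:ℝ) β, Real.rpow_mul hτ, Real.rpow_natCast]

lemma aux_integral (β : ℝ) (hβ : β ∈ Set.Ioo (0:ℝ) 1) (x : ℝ) (hx : 0 < x) :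
    ∫ τ in (0:ℝ)..x, ML β (-(τ ^ β)) * (x - τ) ^ (-β) =
      Real.Gamma (1 - β) * (x ^ (1 - β) / Real.Gamma (2 - β) -
        ∑' n : ℕ, (-1) ^ n * x ^ ((n:ℝ) * β + 1) / Real.Gamma (n * β + 2)) := by
  obtain ⟨h0, h1⟩ := hβ
  have hG (n : ℕ) : 0 < Real.Gamma (n * β + 1) :=
    Real.Gamma_pos_of_pos (by positivity)
  let F : ℕ → ℝ → ℝ := fun n τ =>
    ((-1) ^ n / Real.Gamma (n * β + 1)) * (τ ^ ((n:ℝ) * β) * (x - τ) ^ (-β))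
  have hF (n : ℕ) : Integrable (F n) (volume.restrict (Ioc 0 x)) := by
    have := aux_integrable ((n:ℝ) * β) β x (by positivity) h1
    rw [intervalIntegrable_iff_integrableOn_Ioc_of_le hx.le] at this
    exact this.const_mul _
  have hB (n : ℕ) := aux_beta ((n:ℝ) * β) β x (by positivity) h1 hx
  simp only [intervalIntegral.integral_of_le hx.le] at hB
  have hpow (n : ℕ) : x ^ ((n:ℝ) * β + 1 - β) = x ^ (1 - β) * (x ^ β) ^ n := by
    rw [show (n:ℝ) * β + 1 - β = (1 - β) + β * n by ring, Real.rpow_add hx, Real.rpow_mul hx.le,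
      Real.rpow_natCast]
  have hnorm (n : ℕ) : ∫ τ in Ioc 0 x, ‖F n τ‖ =
      (x ^ (1 - β) * Real.Gamma (1 - β)) * ((x ^ β) ^ n / Real.Gamma (n * β + (2 - β))) := by
    have : ∫ τ in Ioc 0 x, ‖F n τ‖ =
        ∫ τ in Ioc 0 x, (1 / Real.Gamma (n * β + 1)) * (τ ^ ((n:ℝ) * β) * (x - τ) ^ (-β)) := by
      refine setIntegral_congr_fun measurableSet_Ioc (fun τ hτ => ?_)
      have a1 : 0 ≤ τ ^ ((n:ℝ) * β) := Real.rpow_nonneg hτ.1.le _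
      have a2 : 0 ≤ (x - τ) ^ (-β) := Real.rpow_nonneg (sub_nonneg.2 hτ.2) _
      simp only [F, norm_mul, norm_div, norm_pow, norm_neg, norm_one, one_pow, Real.norm_eq_abs,
        abs_of_pos (hG n), abs_of_nonneg a1, abs_of_nonneg a2]
    rw [this, integral_const_mul, hB, hpow, ← add_sub_assoc]
    have := (hG n).ne'
    field_simp
  have hsum : Summable (fun n => ∫ τ in Ioc 0 x, ‖F n τ‖) := by
    simp only [hnorm]
    exact (aux_summable β (2 - β) (x ^ β) h0 (by linarith)).mul_left _
  have key := hasSum_integral_of_summable_integral_norm hF hsum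
  have hint (n : ℕ) : ∫ τ in Ioc 0 x, F n τ =
      Real.Gamma (1 - β) * ((-1) ^ n * x ^ ((n:ℝ) * β + 1 - β) / Real.Gamma (n * β + 2 - β)) := by
    simp only [F]
    rw [integral_const_mul, hB]
    have := (hG n).ne'
    field_simp
  have hLHS : ∫ τ in (0:ℝ)..x, ML β (-(τ ^ β)) * (x - τ) ^ (-β) =
      ∫ τ in Ioc 0 x, ∑' n, F n τ := by
    rw [intervalIntegral.integral_of_le hx.le]
    refine setIntegral_congr_fun measurableSet_Ioc (fun τ hτ => ?_)
    simp only [ML, ML2, F]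
    rw [← tsum_mul_right]
    refine tsum_congr (fun n => ?_)
    rw [aux_pow β τ hτ.1.le]
    ring
  rw [hLHS, ← key.tsum_eq, key.summable.tsum_eq_zero_add]
  simp only [hint]
  rw [tsum_mul_left, ← mul_add, sub_eq_add_neg (x ^ (1 - β) / _), ← tsum_neg]
  congr 1
  congr 1
  · simp
  · refine tsum_congr (fun n => ?_)
    push_cast
    rw [show ((n:ℝ) + 1) * β + 1 - β = n * β + 1 by ring,
      show ((n:ℝ) + 1) * β + 2 - β = n * β + 2 by ring]
    ring

lemma aux_deriv (β : ℝ) (h0 : 0 < β) (t : ℝ) (ht : 0 < t) :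
    HasDerivAt (fun x : ℝ => ∑' n : ℕ, (-1) ^ n * x ^ ((n:ℝ) * β + 1) / Real.Gamma (n * β + 2))
      (ML β (-(t ^ β))) t := by
  have hML : ML β (-(t ^ β)) =
      ∑' n : ℕ, (-1) ^ n * t ^ ((n:ℝ) * β) / Real.Gamma (n * β + 1) := by
    simp only [ML, ML2]
    exact tsum_congr (fun n => by rw [aux_pow β t ht.le])
  rw [hML]
  have hmem : t ∈ Ioo 0 (t + 1) := ⟨ht, by linarith⟩
  refine hasDerivAt_tsum_of_isPreconnected (t := Ioo 0 (t + 1)) (y₀ := t)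
    (u := fun n : ℕ => ((t + 1) ^ β) ^ n / Real.Gamma (n * β + 1))
    (g' := fun (n : ℕ) (y : ℝ) => (-1) ^ n * y ^ ((n:ℝ) * β) / Real.Gamma (n * β + 1))
    (aux_summable β 1 _ h0 le_rfl) isOpen_Ioo isPreconnected_Ioo ?_ ?_ hmem ?_ hmem
  · intro n y hy
    have hp : (0:ℝ) < n * β + 1 := by positivity
    have hd := ((Real.hasDerivAt_rpow_const (x := y) (p := (n:ℝ) * β + 1)
      (Or.inl hy.1.ne')).const_mul ((-1:ℝ) ^ n)).div_const (Real.Gamma (n * β + 2))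
    convert! hd using 1
    rw [show (n:ℝ) * β + 2 = (n * β + 1) + 1 by ring, Real.Gamma_add_one hp.ne',
      add_sub_cancel_right]
    have := (Real.Gamma_pos_of_pos hp).ne'
    field_simp
  · intro n y hy
    have hp : (0:ℝ) < n * β + 1 := by positivity
    have hG := Real.Gamma_pos_of_pos hp
    have hy0 : 0 ≤ y := hy.1.le
    rw [norm_div, norm_mul, norm_pow, norm_neg, norm_one, one_pow, one_mul, Real.norm_eq_abs,
      Real.norm_eq_abs, abs_of_pos hG, abs_of_nonneg (Real.rpow_nonneg hy0 _),
      mul_comm (n:ℝ) β, Real.rpow_mul hy0, Real.rpow_natCast]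
    rw [mul_comm (n:ℝ) β] at hG
    have := hy.2.le
    gcongr
  · have := (aux_summable β 2 (-(t ^ β)) h0 (by norm_num)).mul_left t
    refine this.congr (fun n => ?_)
    rw [aux_pow β t ht.le, Real.rpow_add ht, Real.rpow_one]
    ring


/-- For `β ∈ (0,1)`, `g(t) = E_β(-t^β)` solves the fractional relaxation equation:
its Caputo derivative of order `β` (with `g(0⁺) = 1`) equals `-g(t)` for `t > 0`. -/
theorem mittagLeffler_caputo_relaxation (β : ℝ) (hβ : β ∈ Set.Ioo (0:ℝ) 1)
    (t : ℝ) (ht : 0 < t) :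
    (1 / Real.Gamma (1 - β)) *
        deriv (fun x : ℝ => ∫ τ in (0:ℝ)..x, ML β (-(τ ^ β)) * (x - τ) ^ (-β)) t -
      t ^ (-β) / Real.Gamma (1 - β) = -(ML β (-(t ^ β))) := by
  have h0 := hβ.1
  have h1 : 0 < 1 - β := sub_pos.2 hβ.2
  have hG := (Real.Gamma_pos_of_pos h1).ne'
  have hd : HasDerivAt (fun x : ℝ => Real.Gamma (1 - β) * (x ^ (1 - β) / Real.Gamma (2 - β) -
        ∑' n : ℕ, (-1) ^ n * x ^ ((n:ℝ) * β + 1) / Real.Gamma (n * β + 2)))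
      (Real.Gamma (1 - β) * (((1 - β) * t ^ (1 - β - 1)) / Real.Gamma (2 - β) -
        ML β (-(t ^ β)))) t :=
    (((Real.hasDerivAt_rpow_const (Or.inl ht.ne')).div_const _).sub
      (aux_deriv β h0 t ht)).const_mul _
  have he : (fun x : ℝ => ∫ τ in (0:ℝ)..x, ML β (-(τ ^ β)) * (x - τ) ^ (-β)) =ᶠ[nhds t]
      (fun x : ℝ => Real.Gamma (1 - β) * (x ^ (1 - β) / Real.Gamma (2 - β) -
        ∑' n : ℕ, (-1) ^ n * x ^ ((n:ℝ) * β + 1) / Real.Gamma (n * β + 2))) := by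
    filter_upwards [lt_mem_nhds ht] with x hx
    exact aux_integral β hβ x hx
  rw [he.deriv_eq, hd.deriv, show 2 - β = (1 - β) + 1 by ring, Real.Gamma_add_one h1.ne',
    show 1 - β - 1 = -β by ring]
  field_simp
  ring
end

section
/- Let β ∈ (0,1) and let μ : (0,∞) → ℝ be a nonnegative measurable function whose Laplace transform μ̃(θ) = ∫_0^∞ e^{-θv} μ(v) dv is finite for every θ > 0 and satisfies ∫_0^∞ h(θ)/(θ+s) · μ̃(θ) dθ < ∞, where h(θ) = θ K_β(θ). Then for every s > 0, the Laplace transform of τ ↦ ∫_0^∞ f_β(τ+v) μ(v) dv equals ∫_0^∞ h(θ)/(θ+s) · μ̃(θ) dθ, where f_β(t) = t^{β-1} E_{β,β}(-t^β). -/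
open MeasureTheory Set Filter

theorem aux_strip_ne (β : ℝ) (hβ : β ∈ Set.Ioo (0:ℝ) 1) (w : ℂ) (hw : |w.im| ≤ Real.pi) :
    1 + Complex.exp (β * w) ≠ 0 := by
  intro h
  have h1 : Complex.exp (β * w) = Complex.exp (Real.pi * Complex.I) := by
    rw [Complex.exp_pi_mul_I]; linear_combination h
  have hpi := Real.pi_pos
  have him : |(β * w : ℂ).im| < Real.pi := by
    rw [Complex.im_ofReal_mul, abs_mul, abs_of_pos hβ.1]
    nlinarith [hβ.1, hβ.2, abs_nonneg w.im]
  have him' := abs_lt.1 him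
  have h2 := Complex.exp_inj_of_neg_pi_lt_of_le_pi him'.1 him'.2.le (by simp; linarith) (by simp) h1
  have h3 := congrArg Complex.im h2
  rw [h3] at him'
  simp at him'

theorem aux_exp_eq (a : ℝ) (w : ℂ) (hw : |w.im| ≤ Real.pi) (h : Complex.exp w = Complex.exp a) :
    w = a := by
  obtain ⟨n, hn⟩ := Complex.exp_eq_exp_iff_exists_int.1 h
  have h3 := congrArg Complex.im hn
  simp at h3
  have hpi := Real.pi_pos
  have : n = 0 := by
    rw [h3, abs_le] at hw
    have h1 : (n:ℝ) < 1 := by nlinarith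
    have h2 : (-1:ℝ) < n := by nlinarith
    have h1' : n < 1 := by exact_mod_cast h1
    have h2' : -1 < n := by exact_mod_cast h2
    omega
  simpa [this] using hn

noncomputable def auxN (β a : ℝ) (w : ℂ) : ℂ :=
  1 / (1 + Complex.exp (β * w)) -
    ((Real.exp (a/2) / (1 + Real.exp (β*a)) : ℝ) : ℂ) * Complex.exp (-w/2)

noncomputable def auxG (β a : ℝ) (w : ℂ) : ℂ :=
  dslope (auxN β a) a w * Complex.exp w / dslope Complex.exp a w

theorem auxN_a (β a : ℝ) : auxN β a a = 0 := by
  have h : Real.exp (a/2) * Real.exp (-a/2) = 1 := by rw [← Real.exp_add]; simp; ring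
  have : auxN β a a = ((1 / (1 + Real.exp (β * a)) -
    (Real.exp (a/2) / (1 + Real.exp (β*a))) * Real.exp (-a/2) : ℝ) : ℂ) := by
    simp [auxN]
  rw [this, div_mul_eq_mul_div, h]
  simp

theorem auxG_eq (β a : ℝ) (w : ℂ) (hw : w ≠ a) :
    auxG β a w = auxN β a w * Complex.exp w / (Complex.exp w - Real.exp a) := by
  have h : w - a ≠ 0 := sub_ne_zero.2 hw
  rw [auxG, dslope_of_ne _ hw, dslope_of_ne _ hw, slope_def_field, slope_def_field, auxN_a]
  rw [sub_zero, Complex.ofReal_exp, div_mul_eq_mul_div, div_div_div_cancel_right₀ h]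

theorem auxG_diff (β a : ℝ) (hβ : β ∈ Set.Ioo (0:ℝ) 1) :
    DifferentiableOn ℂ (auxG β a) {w : ℂ | |w.im| ≤ Real.pi} := by
  have hn : {w : ℂ | |w.im| ≤ Real.pi} ∈ nhds (a : ℂ) := by
    have : IsOpen {w : ℂ | |w.im| < Real.pi} :=
      isOpen_lt (by fun_prop) continuous_const
    refine mem_of_superset (this.mem_nhds ?_) (fun w (hw : |w.im| < Real.pi) => hw.le)
    simp [Real.pi_pos]
  refine DifferentiableOn.div (DifferentiableOn.mul ?_ ?_) ?_ ?_
  · rw [Complex.differentiableOn_dslope hn]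
    intro w hw
    have h1 := aux_strip_ne β hβ w hw
    unfold auxN
    apply DifferentiableAt.differentiableWithinAt
    fun_prop (disch := assumption)
  · exact Complex.differentiable_exp.differentiableOn
  · rw [Complex.differentiableOn_dslope hn]
    exact Complex.differentiable_exp.differentiableOn
  · intro w hw
    by_cases h : w = a
    · rw [h, dslope_same, Complex.deriv_exp]; exact Complex.exp_ne_zero _
    · rw [dslope_of_ne _ h, slope_def_field]
      refine div_ne_zero (sub_ne_zero.2 fun h' => h (aux_exp_eq a w hw h')) (sub_ne_zero.2 h)

noncomputable def auxB (β a x : ℝ) : ℝ :=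
  (1 / |1 - Real.exp (β*x)| + (Real.exp (a/2) / (1 + Real.exp (β*a))) * Real.exp (-x/2)) *
    (Real.exp x / |Real.exp x - Real.exp a|)

theorem auxG_bound (β a : ℝ) (hβ : β ∈ Set.Ioo (0:ℝ) 1) (x y : ℝ) (h0 : x ≠ 0) (ha : x ≠ a) :
    ‖auxG β a (x + y * Complex.I)‖ ≤ auxB β a x := by
  have hne : (x + y * Complex.I : ℂ) ≠ a := by
    intro h; apply ha; simpa using congrArg Complex.re h
  rw [auxG_eq _ _ _ hne, mul_div_assoc, norm_mul, norm_div]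
  unfold auxB
  have n1 : ‖Complex.exp (x + y * Complex.I)‖ = Real.exp x := by rw [Complex.norm_exp]; simp
  have n2 : ‖Complex.exp (β * (x + y * Complex.I))‖ = Real.exp (β * x) := by
    rw [Complex.norm_exp]; simp
  have n3 : ‖Complex.exp (-(x + y * Complex.I)/2)‖ = Real.exp (-x/2) := by
    rw [Complex.norm_exp]
    congr 1
    rw [show -(x + y * Complex.I : ℂ)/2 = ((-x/2 : ℝ) : ℂ) + ((-y/2 : ℝ):ℂ) * Complex.I by
      push_cast; ring]
    simp
  have hβ0 := hβ.1
  have p1 : 0 < |1 - Real.exp (β*x)| := by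
    rw [abs_pos, sub_ne_zero]
    intro h
    have := Real.exp_eq_one_iff _ |>.1 h.symm
    simp [hβ0.ne', h0] at this
  have p2 : 0 < |Real.exp x - Real.exp a| := by
    rw [abs_pos, sub_ne_zero]
    exact fun h => ha (Real.exp_injective h)
  rw [n1]
  gcongr
  · unfold auxN
    refine (norm_sub_le _ _).trans ?_
    rw [norm_mul, n3, norm_div, norm_one, Complex.norm_real, Real.norm_of_nonneg (by positivity)]
    gcongr
    have := abs_norm_sub_norm_le (1:ℂ) (-Complex.exp (β * (x + y * Complex.I)))
    rwa [norm_one, norm_neg, n2, sub_neg_eq_add] at this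
  · have := abs_norm_sub_norm_le (Complex.exp (x + y * Complex.I)) (Real.exp a : ℂ)
    rwa [n1, Complex.norm_real, Real.norm_of_nonneg (Real.exp_pos a).le] at this

theorem auxB_top (β a : ℝ) (hβ : β ∈ Set.Ioo (0:ℝ) 1) :
    Tendsto (auxB β a) atTop (nhds 0) := by
  have e1 : Tendsto (fun x : ℝ => Real.exp (-x/2)) atTop (nhds 0) := by
    refine Real.tendsto_exp_atBot.comp ?_
    have := tendsto_neg_atTop_atBot.comp (tendsto_id.atTop_div_const (by norm_num : (0:ℝ) < 2))
    refine this.congr (fun x => by simp [neg_div])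
  have e2 : Tendsto (fun x : ℝ => Real.exp (-x)) atTop (nhds 0) :=
    Real.tendsto_exp_neg_atTop_nhds_zero
  have e3 : Tendsto (fun x : ℝ => 1 / |1 - Real.exp (β*x)|) atTop (nhds 0) := by
    simp_rw [one_div]
    refine tendsto_inv_atTop_zero.comp (tendsto_abs_atBot_atTop.comp ?_)
    have : Tendsto (fun x : ℝ => Real.exp (β * x)) atTop atTop :=
      Real.tendsto_exp_atTop.comp (tendsto_id.const_mul_atTop hβ.1)
    exact tendsto_atBot_add_const_left _ 1 (tendsto_neg_atTop_atBot.comp this)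
  have e4 : Tendsto (fun x : ℝ => 1 / |1 - Real.exp a * Real.exp (-x)|) atTop
      (nhds (1 / |1 - Real.exp a * 0|)) := by
    exact tendsto_const_nhds.div ((tendsto_const_nhds.sub (e2.const_mul _)).abs) (by simp)
  have := ((e3.add (e1.const_mul (Real.exp (a/2) / (1 + Real.exp (β*a))))).mul e4)
  simp only [mul_zero, add_zero, zero_mul] at this
  refine this.congr (fun x => ?_)
  unfold auxB
  congr 1
  have : Real.exp x - Real.exp a = Real.exp x * (1 - Real.exp a * Real.exp (-x)) := by
    rw [Real.exp_neg]; field_simp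
  rw [this, abs_mul, abs_of_pos (Real.exp_pos x), div_mul_eq_div_div, div_self (Real.exp_ne_zero x)]

theorem auxB_bot (β a : ℝ) (hβ : β ∈ Set.Ioo (0:ℝ) 1) :
    Tendsto (auxB β a) atBot (nhds 0) := by
  have e1 : Tendsto (fun x : ℝ => Real.exp (x/2)) atBot (nhds 0) :=
    Real.tendsto_exp_atBot.comp (tendsto_id.atBot_div_const (by norm_num : (0:ℝ) < 2))
  have e2 : Tendsto (fun x : ℝ => Real.exp x) atBot (nhds 0) := Real.tendsto_exp_atBot
  have e3 : Tendsto (fun x : ℝ => 1 / |1 - Real.exp (β*x)|) atBot (nhds (1 / |1-0|)) := by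
    refine tendsto_const_nhds.div ((tendsto_const_nhds.sub ?_).abs) (by simp)
    exact Real.tendsto_exp_atBot.comp (tendsto_id.const_mul_atBot hβ.1)
  have e4 : Tendsto (fun x : ℝ => 1 / |Real.exp x - Real.exp a|) atBot
      (nhds (1 / |0 - Real.exp a|)) := by
    exact tendsto_const_nhds.div ((e2.sub tendsto_const_nhds).abs) (by simp)
  have := (((e3.mul e2).add (e1.const_mul (Real.exp (a/2) / (1 + Real.exp (β*a))))).mul e4)
  simp only [mul_zero, add_zero, zero_mul] at this
  refine this.congr (fun x => ?_)
  unfold auxB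
  have : Real.exp (x/2) = Real.exp (-x/2) * Real.exp x := by rw [← Real.exp_add]; congr 1; ring
  rw [this]
  ring

noncomputable def auxH (β x : ℝ) : ℝ :=
  Real.sin (β * Real.pi) * Real.exp (β * x) /
    (Real.exp (β*x) ^ 2 + 2 * Real.exp (β*x) * Real.cos (β * Real.pi) + 1)

theorem auxden_pos (β u : ℝ) (hβ : β ∈ Set.Ioo (0:ℝ) 1) :
    0 < u ^ 2 + 2 * u * Real.cos (β * Real.pi) + 1 := by
  have hpi := Real.pi_pos
  have : 0 < Real.sin (β * Real.pi) := Real.sin_pos_of_pos_of_lt_pi (by have := hβ.1; positivity) (by nlinarith [hβ.2])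
  nlinarith [sq_nonneg (u + Real.cos (β * Real.pi)), Real.sin_sq_add_cos_sq (β * Real.pi), pow_pos this 2]

theorem auxG_jump (β a : ℝ) (hβ : β ∈ Set.Ioo (0:ℝ) 1) (x : ℝ) :
    auxG β a (x + ((-Real.pi : ℝ) : ℂ) * Complex.I) - auxG β a (x + (Real.pi : ℂ) * Complex.I) =
      2 * Complex.I * (((auxH β x - (Real.exp (a/2) / (1 + Real.exp (β*a))) * Real.exp (-x/2)) *
        (Real.exp x / (Real.exp x + Real.exp a)) : ℝ) : ℂ) := by
  have hpi := Real.pi_pos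
  have m1 : (x + ((-Real.pi : ℝ) : ℂ) * Complex.I) ≠ a := by
    intro h; have := congrArg Complex.im h; simp at this
  have m2 : (x + (Real.pi : ℂ) * Complex.I) ≠ a := by
    intro h; have := congrArg Complex.im h; simp at this
  have q1 := aux_strip_ne β hβ (x + ((-Real.pi : ℝ) : ℂ) * Complex.I) (by simp [abs_of_pos hpi])
  have q2 := aux_strip_ne β hβ (x + (Real.pi : ℂ) * Complex.I) (by simp [abs_of_pos hpi])
  rw [auxG_eq _ _ _ m1, auxG_eq _ _ _ m2]
  have x1 : Complex.exp (x + ((-Real.pi : ℝ) : ℂ) * Complex.I) = -(Real.exp x : ℂ) := by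
    rw [Complex.exp_add]; simp [Complex.exp_neg]
  have x2 : Complex.exp (x + (Real.pi : ℂ) * Complex.I) = -(Real.exp x : ℂ) := by
    rw [Complex.exp_add]; simp
  have y1 : Complex.exp (-(x + ((-Real.pi : ℝ) : ℂ) * Complex.I)/2) =
      Real.exp (-x/2) * Complex.I := by
    rw [show -(x + ((-Real.pi : ℝ) : ℂ) * Complex.I)/2 = ((-x/2 : ℝ) : ℂ) +
      (Real.pi / 2 * Complex.I) by push_cast; ring, Complex.exp_add, Complex.exp_pi_div_two_mul_I,
      Complex.ofReal_exp]
  have y2 : Complex.exp (-(x + (Real.pi : ℂ) * Complex.I)/2) =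
      -(Real.exp (-x/2) * Complex.I) := by
    rw [show -(x + (Real.pi : ℂ) * Complex.I)/2 = ((-x/2 : ℝ) : ℂ) +
      (-Real.pi / 2 * Complex.I) by push_cast; ring, Complex.exp_add, Complex.exp_neg_pi_div_two_mul_I,
      Complex.ofReal_exp]
    ring
  have z1 : Complex.exp (β * (x + ((-Real.pi : ℝ) : ℂ) * Complex.I)) =
      Real.exp (β*x) * (Real.cos (β * Real.pi) - Real.sin (β * Real.pi) * Complex.I) := by
    rw [show (β * (x + ((-Real.pi : ℝ) : ℂ) * Complex.I)) = ((β*x : ℝ) : ℂ) +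
      ((-(β * Real.pi) : ℝ) : ℂ) * Complex.I by push_cast; ring, Complex.exp_add, Complex.exp_mul_I,
      ← Complex.ofReal_cos, ← Complex.ofReal_sin, Real.cos_neg, Real.sin_neg,
      Complex.ofReal_exp]
    push_cast; ring
  have z2 : Complex.exp (β * (x + (Real.pi : ℂ) * Complex.I)) =
      Real.exp (β*x) * (Real.cos (β * Real.pi) + Real.sin (β * Real.pi) * Complex.I) := by
    rw [show (β * (x + (Real.pi : ℂ) * Complex.I)) = ((β*x : ℝ) : ℂ) +
      (((β * Real.pi) : ℝ) : ℂ) * Complex.I by push_cast; ring, Complex.exp_add, Complex.exp_mul_I,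
      ← Complex.ofReal_cos, ← Complex.ofReal_sin,
      Complex.ofReal_exp]
  unfold auxN auxH
  rw [z1] at q1
  rw [z2] at q2
  rw [x1, x2, y1, y2, z1, z2]
  have hd := (auxden_pos β (Real.exp (β*x)) hβ).ne'
  have hd' : ((Real.exp (β*x) ^ 2 + 2 * Real.exp (β*x) * Real.cos (β * Real.pi) + 1 : ℝ) : ℂ) ≠ 0 := by
    exact_mod_cast hd
  have hs : (Real.exp x + Real.exp a : ℂ) ≠ 0 := by
    have : Real.exp x + Real.exp a ≠ 0 := by positivity
    exact_mod_cast this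
  have hk : -(Real.exp x : ℂ) / (-(Real.exp x : ℂ) - Real.exp a) =
      Real.exp x / (Real.exp x + Real.exp a) := by
    rw [← neg_add', neg_div_neg_eq]
  have hj : 1 / (1 + Real.exp (β*x) * (Real.cos (β * Real.pi) - Real.sin (β * Real.pi) * Complex.I)) -
     1 / (1 + Real.exp (β*x) * (Real.cos (β * Real.pi) + Real.sin (β * Real.pi) * Complex.I)) =
     2 * Complex.I * ((Real.sin (β * Real.pi) * Real.exp (β * x) /
    (Real.exp (β*x) ^ 2 + 2 * Real.exp (β*x) * Real.cos (β * Real.pi) + 1) : ℝ) : ℂ) := by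
    rw [div_sub_div _ _ q1 q2, Complex.ofReal_div, mul_div_assoc', div_eq_div_iff (mul_ne_zero q1 q2) hd']
    have hsc : (Real.sin (β * Real.pi) : ℂ)^2 + (Real.cos (β * Real.pi) : ℂ)^2 = 1 := by
      exact_mod_cast Real.sin_sq_add_cos_sq (β * Real.pi)
    generalize hS : (Real.sin (β * Real.pi)) = S at *
    generalize hC : (Real.cos (β * Real.pi)) = C at *
    generalize hE : (Real.exp (β * x)) = E at *
    have hI := Complex.I_sq
    push_cast
    linear_combination (-2 * Complex.I * S * E^3) * hsc + (2 * Complex.I * S^3 * E^3) * hI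
  rw [mul_div_assoc, mul_div_assoc, hk, ← sub_mul, Complex.ofReal_mul, Complex.ofReal_sub,
    Complex.ofReal_div (Real.exp x), Complex.ofReal_add, ← mul_assoc (2 * Complex.I)]
  congr 1
  rw [Complex.ofReal_mul (Real.exp (a/2) / (1 + Real.exp (β*a)))]
  linear_combination hj

theorem aux_claimA (β a : ℝ) (hβ : β ∈ Set.Ioo (0:ℝ) 1) :
    Tendsto (fun R : ℝ => ∫ x in (-R)..R, auxH β x * (Real.exp x / (Real.exp x + Real.exp a)))
      atTop (nhds (Real.pi / (1 + Real.exp (β * a)))) := by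
  have hpi := Real.pi_pos
  set c : ℝ := Real.exp (a/2) / (1 + Real.exp (β*a)) with hc
  have hG := auxG_diff β a hβ
  have hHc : Continuous (auxH β) := by
    unfold auxH
    refine Continuous.div (by fun_prop) (by fun_prop) (fun x => (auxden_pos β _ hβ).ne')
  have hkc : Continuous (fun x : ℝ => Real.exp x / (Real.exp x + Real.exp a)) :=
    Continuous.div (by fun_prop) (by fun_prop) (fun x => by positivity)
  set q : ℝ → ℝ := fun x => (auxH β x - c * Real.exp (-x/2)) *
        (Real.exp x / (Real.exp x + Real.exp a)) with hq
  have line : ∀ y : ℝ, |y| ≤ Real.pi → Continuous (fun x : ℝ => auxG β a (x + (y:ℂ) * Complex.I)) := by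
    intro y hy
    refine hG.continuousOn.comp_continuous (by fun_prop) (fun x => ?_)
    simpa using hy
  have c1 := line (-Real.pi) (by simp [abs_of_pos hpi])
  have c2 := line (Real.pi) (by simp [abs_of_pos hpi])
  have hqlim : Tendsto (fun R : ℝ => ∫ x in (-R)..R, q x) atTop (nhds 0) := by
    have hB : Tendsto (fun R : ℝ => Real.pi * (auxB β a R + auxB β a (-R))) atTop (nhds 0) := by
      have := ((auxB_top β a hβ).add ((auxB_bot β a hβ).comp tendsto_neg_atTop_atBot)).const_mul Real.pi
      simpa using this
    refine squeeze_zero_norm' ?_ hB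
    filter_upwards [eventually_gt_atTop 0, eventually_gt_atTop |a|] with R hR0 hRa
    have hRa' := abs_lt.1 hRa
    have hrect := Complex.integral_boundary_rect_eq_zero_of_differentiableOn (auxG β a)
      (⟨-R, -Real.pi⟩) (⟨R, Real.pi⟩) (hG.mono (by
        intro w hw
        have := hw.2
        simp only [mem_preimage, uIcc_of_le (by linarith : -Real.pi ≤ Real.pi)] at this
        exact abs_le.2 this))
    simp only at hrect
    rw [← intervalIntegral.integral_sub (c1.intervalIntegrable _ _) (c2.intervalIntegrable _ _)] at hrect
    simp_rw [auxG_jump β a hβ] at hrect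
    rw [intervalIntegral.integral_const_mul, intervalIntegral.integral_ofReal] at hrect
    have b1 := intervalIntegral.norm_integral_le_of_norm_le_const (a := -Real.pi) (b := Real.pi)
      (f := fun y : ℝ => auxG β a (R + y * Complex.I)) (C := auxB β a R)
      (fun y _ => auxG_bound β a hβ R y hR0.ne' (by linarith [hRa'.2] : a < R).ne')
    have b2 := intervalIntegral.norm_integral_le_of_norm_le_const (a := -Real.pi) (b := Real.pi)
      (f := fun y : ℝ => auxG β a (((-R : ℝ):ℂ) + y * Complex.I)) (C := auxB β a (-R))
      (fun y _ => auxG_bound β a hβ (-R) y (by linarith : -R < 0).ne (by linarith [hRa'.1] : -R < a).ne)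
    set V1 := ∫ y in (-Real.pi)..Real.pi, auxG β a (R + y * Complex.I)
    set V2 := ∫ y in (-Real.pi)..Real.pi, auxG β a (((-R : ℝ):ℂ) + y * Complex.I)
    have hh : ((∫ x in (-R)..R, q x : ℝ) : ℂ) = (V2 - V1) / 2 := by
      have hI : Complex.I ≠ 0 := Complex.I_ne_zero
      apply mul_left_cancel₀ hI
      simp only [smul_eq_mul] at hrect
      linear_combination hrect / 2
    rw [← Complex.norm_real, hh, norm_div]
    have habs : |Real.pi - -Real.pi| = 2 * Real.pi := by
      rw [abs_of_pos (by linarith)]; ring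
    rw [habs] at b1 b2
    have := norm_sub_le V2 V1
    simp only [Complex.norm_ofNat]
    linarith
  have harc : ∀ R : ℝ, ∫ x in (-R)..R, Real.exp (-x/2) * (Real.exp x / (Real.exp x + Real.exp a)) =
      2 * Real.exp (-a/2) * Real.arctan (Real.exp ((R-a)/2)) -
      2 * Real.exp (-a/2) * Real.arctan (Real.exp ((-R-a)/2)) := by
    intro R
    refine intervalIntegral.integral_eq_sub_of_hasDerivAt
      (f := fun x => 2 * Real.exp (-a/2) * Real.arctan (Real.exp ((x-a)/2))) (fun x _ => ?_) ?_
    · have h1 : HasDerivAt (fun x : ℝ => (x-a)/2) (1/2) x :=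
        ((hasDerivAt_id x).sub_const a).div_const 2
      have := (h1.exp.arctan).const_mul (2 * Real.exp (-a/2))
      refine this.congr_deriv ?_
      have t1 : Real.exp ((x-a)/2) = Real.exp (x/2) * Real.exp (-a/2) := by
        rw [← Real.exp_add]; congr 1; ring
      have t2 : Real.exp x = Real.exp (x/2)^2 := by
        rw [← Real.exp_nat_mul]; congr 1; push_cast; ring
      have t3 : Real.exp (-x/2) = (Real.exp (x/2))⁻¹ := by
        rw [← Real.exp_neg]; congr 1; ring
      have t4 : Real.exp a = (Real.exp (-a/2)^2)⁻¹ := by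
        rw [← Real.exp_nat_mul, ← Real.exp_neg]; congr 1; push_cast; ring
      rw [t1, t2, t3, t4]
      have := Real.exp_pos (x/2)
      have := Real.exp_pos (-a/2)
      generalize Real.exp (x/2) = X at *
      generalize Real.exp (-a/2) = Y at *
      field_simp
      ring
    · apply Continuous.intervalIntegrable
      exact Continuous.mul (by fun_prop) hkc
  have hA : Tendsto (fun R : ℝ => 2 * Real.exp (-a/2) * Real.arctan (Real.exp ((R-a)/2)) -
      2 * Real.exp (-a/2) * Real.arctan (Real.exp ((-R-a)/2))) atTop
      (nhds (2 * Real.exp (-a/2) * (Real.pi/2) - 2 * Real.exp (-a/2) * 0)) := by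
    refine Tendsto.sub (Tendsto.const_mul _ ?_) (Tendsto.const_mul _ ?_)
    · have h1 : Tendsto (fun R : ℝ => (R - a)/2) atTop atTop :=
        (tendsto_atTop_add_const_right _ (-a) tendsto_id).atTop_div_const (by norm_num)
      exact (tendsto_nhds_of_tendsto_nhdsWithin Real.tendsto_arctan_atTop).comp
        (Real.tendsto_exp_atTop.comp h1)
    · have h1 : Tendsto (fun R : ℝ => (-R - a)/2) atTop atBot :=
        (tendsto_atBot_add_const_right _ (-a) tendsto_neg_atTop_atBot).atBot_div_const (by norm_num)
      have h2 := (Real.continuous_arctan.tendsto 0).comp (Real.tendsto_exp_atBot.comp h1)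
      rw [Real.arctan_zero] at h2
      exact h2
  have hfin := hqlim.add (hA.const_mul c)
  have hval : 0 + c * (2 * Real.exp (-a/2) * (Real.pi/2) - 2 * Real.exp (-a/2) * 0) =
      Real.pi / (1 + Real.exp (β * a)) := by
    have h : Real.exp (a/2) * Real.exp (-a/2) = 1 := by rw [← Real.exp_add]; simp; ring
    rw [hc, zero_add, div_mul_eq_mul_div]
    congr 1
    linear_combination Real.pi * h
  rw [hval] at hfin
  refine hfin.congr (fun R => ?_)
  rw [← harc R, ← intervalIntegral.integral_const_mul, ← intervalIntegral.integral_add]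
  · congr 1; funext x; simp only [hq]; ring
  · apply Continuous.intervalIntegrable
    exact Continuous.mul (by fun_prop) hkc
  · apply Continuous.intervalIntegrable
    exact Continuous.mul continuous_const (Continuous.mul (by fun_prop) hkc)
theorem aux_integrable_tsum {α : Type*} [MeasurableSpace α] {W : Measure α} (F : ℕ → α → ℝ)
    (hi : ∀ n, Integrable (F n) W) (hs : Summable fun n => ∫ a, ‖F n a‖ ∂W) :
    Integrable (fun a => ∑' n, F n a) W := by
  have h1 : ∑' n, ∫⁻ a, ‖F n a‖ₑ ∂W ≠ ⊤ := by
    have (i : ℕ) : ∫⁻ a, ‖F i a‖ₑ ∂W = ENNReal.ofReal (∫ a, ‖F i a‖ ∂W) := by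
      rw [ofReal_integral_norm_eq_lintegral_enorm (hi i)]
    rw [funext this]
    exact hs.tsum_ofReal_ne_top
  have h2 : ∫⁻ a, ∑' n, ‖F n a‖ₑ ∂W ≠ ⊤ := by
    rwa [lintegral_tsum (fun n => (hi n).1.enorm)]
  have h3 : ∀ᵐ a ∂W, ∑' n, ‖F n a‖ₑ < ⊤ :=
    ae_lt_top' (AEMeasurable.tsum fun n => (hi n).1.enorm) h2
  have h4 : ∀ᵐ a ∂W, Summable fun n => ‖F n a‖ := by
    filter_upwards [h3] with a ha
    have := ENNReal.summable_toReal ha.ne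
    simpa using this
  refine ⟨?_, ?_⟩
  · refine aestronglyMeasurable_of_tendsto_ae atTop
      (f := fun N a => ∑ n ∈ Finset.range N, F n a) ?_ ?_
    · intro N
      exact Finset.aestronglyMeasurable_fun_sum _ (fun n _ => (hi n).1)
    · filter_upwards [h4] with a ha
      exact ha.of_norm.hasSum.tendsto_sum_nat
  · refine lt_of_le_of_lt (lintegral_mono_ae ?_) h2.lt_top
    filter_upwards [h4] with a ha
    rw [← ofReal_norm, ]
    refine (ENNReal.ofReal_le_ofReal (norm_tsum_le_tsum_norm ha)).trans ?_
    rw [ENNReal.ofReal_tsum_of_nonneg (fun _ => norm_nonneg _) ha]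
    simp only [ofReal_norm, le_refl]

theorem aux_laplace_f (β : ℝ) (hβ : β ∈ Set.Ioo (0:ℝ) 1) (s : ℝ) (hs : 1 < s) :
    IntegrableOn (fun t => fML β t * Real.exp (-(s*t))) (Ioi 0) ∧
    ∫ t in Ioi (0:ℝ), fML β t * Real.exp (-(s*t)) = 1 / (1 + s ^ β) := by
  have hβ0 := hβ.1
  have s0 : 0 < s := by linarith
  set F : ℕ → ℝ → ℝ := fun n t => ((-1)^n / Real.Gamma (n*β+β)) *
    (t ^ ((n*β+β) - 1) * Real.exp (-(s*t))) with hF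
  have hpos : ∀ n : ℕ, 0 < (n:ℝ)*β+β := fun n => by positivity
  have hG : ∀ n : ℕ, 0 < Real.Gamma ((n:ℝ)*β+β) := fun n => Real.Gamma_pos_of_pos (hpos n)
  have hb : ∀ n : ℕ, IntegrableOn (fun t : ℝ => t ^ (((n:ℝ)*β+β) - 1) * Real.exp (-(s*t))) (Ioi 0) := by
    intro n
    have := integrableOn_rpow_mul_exp_neg_mul_rpow (p := 1) (s := (n*β+β) - 1) (b := s)
      (by linarith [hpos n]) (by norm_num) s0
    simpa using this
  have hi : ∀ n, Integrable (F n) (volume.restrict (Ioi 0)) := fun n => (hb n).const_mul _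
  have hr : ∀ n : ℕ, (1 / s) ^ ((n:ℝ)*β+β) = ((s^β)⁻¹) * ((s^β)⁻¹)^n := by
    intro n
    rw [one_div, Real.rpow_add (by positivity), mul_comm (n:ℝ), Real.rpow_mul (by positivity), Real.rpow_natCast,
      Real.inv_rpow s0.le, mul_comm]
  have hint : ∀ n, ∫ t in Ioi (0:ℝ), F n t = ((s^β)⁻¹) * (-(s^β)⁻¹)^n := by
    intro n
    rw [hF]; simp only
    rw [integral_const_mul, Real.integral_rpow_mul_exp_neg_mul_Ioi (hpos n) s0, hr, neg_pow ((s^β)⁻¹) n]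
    have := (hG n).ne'
    rw [div_mul_eq_mul_div, div_eq_iff this]
    ring
  have hnorm : ∀ n, ∫ t in Ioi (0:ℝ), ‖F n t‖ = ((s^β)⁻¹) * ((s^β)⁻¹)^n := by
    intro n
    rw [setIntegral_congr_fun (g := fun t => (1 / Real.Gamma (n*β+β)) *
    (t ^ ((n*β+β) - 1) * Real.exp (-(s*t)))) measurableSet_Ioi]
    · rw [integral_const_mul, Real.integral_rpow_mul_exp_neg_mul_Ioi (hpos n) s0, hr]
      have := (hG n).ne'
      field_simp
    · intro t ht
      have ht : 0 < t := ht
      simp only [hF]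
      rw [norm_mul, norm_div, norm_pow, norm_neg, norm_one, one_pow, Real.norm_of_nonneg (hG n).le,
        Real.norm_of_nonneg (by positivity)]
  have hs1 : 1 < s^β := Real.one_lt_rpow hs hβ0
  have hq : (s^β)⁻¹ < 1 := inv_lt_one_of_one_lt₀ hs1
  have hq0 : 0 < (s^β)⁻¹ := by positivity
  have hsum : Summable fun n => ∫ t in Ioi (0:ℝ), ‖F n t‖ := by
    rw [funext hnorm]
    exact (summable_geometric_of_lt_one hq0.le hq).mul_left _
  have hfe : EqOn (fun t => fML β t * Real.exp (-(s*t))) (fun t => ∑' n, F n t) (Ioi 0) := by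
    intro t ht
    have ht : 0 < t := ht
    simp only [fML, ML2, hF]
    rw [← tsum_mul_left, ← tsum_mul_right]
    congr 1; funext n
    rw [neg_pow, ← Real.rpow_natCast (t^β), ← Real.rpow_mul ht.le,
      show (n:ℝ)*β+β-1 = (β-1) + β * n by ring, Real.rpow_add ht]
    ring
  refine ⟨?_, ?_⟩
  · rw [integrableOn_congr_fun hfe measurableSet_Ioi]
    exact aux_integrable_tsum F hi hsum
  · rw [setIntegral_congr_fun measurableSet_Ioi hfe,
      ← integral_tsum_of_summable_integral_norm hi hsum, funext hint, tsum_mul_left,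
      tsum_geometric_of_norm_lt_one (by rw [norm_neg, Real.norm_of_nonneg hq0.le]; exact hq)]
    have e1 : 1 - -(s^β)⁻¹ = (1 + s^β) * (s^β)⁻¹ := by field_simp; ring
    rw [e1, mul_inv, inv_inv]
    field_simp

theorem aux_meas_ext (μ ν : Measure ℝ) [IsFiniteMeasure μ] [IsFiniteMeasure ν]
    (h1 : ∀ t ∈ Ioo (-1:ℝ) 1, Integrable (fun x => Real.exp (t * x)) μ)
    (h2 : ∀ t ∈ Ioo (-1:ℝ) 1, Integrable (fun x => Real.exp (t * x)) ν)
    (h : ∀ t ∈ Ioo (-1:ℝ) 1, ∫ x, Real.exp (t * x) ∂μ = ∫ x, Real.exp (t * x) ∂ν) : μ = ν := by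
  have key : ∀ μ : Measure ℝ, (∀ t ∈ Ioo (-1:ℝ) 1, Integrable (fun x => Real.exp (t * x)) μ) →
      AnalyticOnNhd ℂ (ProbabilityTheory.complexMGF id μ) {z | z.re ∈ Ioo (-1:ℝ) 1} := by
    intro μ hμ
    refine (ProbabilityTheory.analyticOnNhd_complexMGF (X := id) (μ := μ)).mono ?_
    intro z hz
    exact (interior_maximal (fun t ht => hμ t ht) isOpen_Ioo) hz
  have heq : Set.EqOn (ProbabilityTheory.complexMGF id μ) (ProbabilityTheory.complexMGF id ν)
      {z | z.re ∈ Ioo (-1:ℝ) 1} := by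
    refine AnalyticOnNhd.eqOn_of_preconnected_of_frequently_eq (key μ h1) (key ν h2)
      ((convex_Ioo (-1:ℝ) 1).linear_preimage Complex.reLm).isPreconnected
      (z₀ := ((0:ℝ) : ℂ)) (by simp) ?_
    have h_real : ∃ᶠ (x : ℝ) in nhdsWithin 0 {0}ᶜ, ProbabilityTheory.complexMGF id μ x =
        ProbabilityTheory.complexMGF id ν x := by
      apply Eventually.frequently
      have : Ioo (-1:ℝ) 1 ∈ nhdsWithin (0:ℝ) {0}ᶜ :=
        mem_nhdsWithin_of_mem_nhds (Ioo_mem_nhds (by norm_num) (by norm_num))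
      filter_upwards [this] with y hy
      rw [ProbabilityTheory.complexMGF_ofReal, ProbabilityTheory.complexMGF_ofReal]
      exact congrArg _ (h y hy)
    rw [frequently_iff_seq_forall] at h_real ⊢
    obtain ⟨xs, hx_tendsto, hx_eq⟩ := h_real
    refine ⟨fun n ↦ xs n, ?_, fun n ↦ ?_⟩
    · rw [tendsto_nhdsWithin_iff] at hx_tendsto ⊢
      constructor
      · rw [tendsto_ofReal_iff]
        exact hx_tendsto.1
      · simpa using hx_tendsto.2
    · simp [hx_eq]
  apply Measure.ext_of_charFun
  funext t
  rw [← ProbabilityTheory.complexMGF_id_mul_I, ← ProbabilityTheory.complexMGF_id_mul_I]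
  exact heq (by simp)

theorem aux_laplace_inj (D : ℝ → ℝ)
    (hi : ∀ s : ℝ, 1 < s → IntegrableOn (fun t => D t * Real.exp (-(s*t))) (Ioi 0))
    (h0 : ∀ s : ℝ, 1 < s → ∫ t in Ioi (0:ℝ), D t * Real.exp (-(s*t)) = 0) :
    ∀ᵐ t ∂(volume.restrict (Ioi (0:ℝ))), D t = 0 := by
  set W := volume.restrict (Ioi (0:ℝ)) with hW
  set F : ℝ → ℝ := fun t => D t * Real.exp (-(3*t)) with hF
  have hFi : Integrable F W := hi 3 (by norm_num)
  have hFt : ∀ t ∈ Ioo (-1:ℝ) 1, Integrable (fun x => F x * Real.exp (t*x)) W ∧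
      ∫ x, F x * Real.exp (t*x) ∂W = 0 := by
    intro t ht
    have e : (fun x => F x * Real.exp (t*x)) = fun x => D x * Real.exp (-((3-t)*x)) := by
      funext x
      rw [hF]; simp only
      rw [mul_assoc, ← Real.exp_add]; congr 2; ring
    rw [e]
    exact ⟨hi (3-t) (by linarith [ht.2]), h0 (3-t) (by linarith [ht.2])⟩
  have ham : AEMeasurable (fun t => ENNReal.ofReal (F t)) W := hFi.aemeasurable.ennreal_ofReal
  have hbm : AEMeasurable (fun t => ENNReal.ofReal (-F t)) W := hFi.neg.aemeasurable.ennreal_ofReal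
  have fa : IsFiniteMeasure (W.withDensity (fun t => ENNReal.ofReal (F t))) :=
    isFiniteMeasure_withDensity_ofReal hFi.2
  have fb : IsFiniteMeasure (W.withDensity (fun t => ENNReal.ofReal (-F t))) :=
    isFiniteMeasure_withDensity_ofReal hFi.neg.2
  have I1 : ∀ t ∈ Ioo (-1:ℝ) 1, Integrable (fun x => max (F x) 0 * Real.exp (t*x)) W := by
    intro t ht
    refine (hFt t ht).1.mono ((hFi.aestronglyMeasurable.sup aestronglyMeasurable_const).mul
      (by fun_prop)) (Eventually.of_forall fun x => ?_)
    rw [norm_mul, norm_mul]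
    gcongr
    rw [Real.norm_of_nonneg (le_max_right _ _)]
    exact max_le (le_abs_self _) (abs_nonneg _)
  have I2 : ∀ t ∈ Ioo (-1:ℝ) 1, Integrable (fun x => max (-F x) 0 * Real.exp (t*x)) W := by
    intro t ht
    refine (hFt t ht).1.mono ((hFi.neg.aestronglyMeasurable.sup aestronglyMeasurable_const).mul
      (by fun_prop)) (Eventually.of_forall fun x => ?_)
    rw [norm_mul, norm_mul]
    gcongr
    rw [Real.norm_of_nonneg (le_max_right _ _)]
    exact max_le (neg_le_abs _) (abs_nonneg _)
  have hm := aux_meas_ext (W.withDensity (fun t => ENNReal.ofReal (F t)))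
    (W.withDensity (fun t => ENNReal.ofReal (-F t))) ?_ ?_ ?_
  · rw [withDensity_eq_iff_of_sigmaFinite ham hbm] at hm
    filter_upwards [hm] with t ht
    have : F t = 0 := by
      rcases le_total 0 (F t) with h | h
      · rw [ENNReal.ofReal_of_nonpos (by linarith : -F t ≤ 0), ENNReal.ofReal_eq_zero] at ht
        linarith
      · rw [ENNReal.ofReal_of_nonpos h] at ht
        have := ENNReal.ofReal_eq_zero.1 ht.symm
        linarith
    rw [hF] at this
    simpa [Real.exp_ne_zero] using this
  · intro t ht
    rw [integrable_withDensity_iff_integrable_smul₀' ham (by simp)]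
    simpa [ENNReal.toReal_ofReal'] using I1 t ht
  · intro t ht
    rw [integrable_withDensity_iff_integrable_smul₀' hbm (by simp)]
    simpa [ENNReal.toReal_ofReal'] using I2 t ht
  · intro t ht
    rw [integral_withDensity_eq_integral_toReal_smul₀ ham (by simp),
      integral_withDensity_eq_integral_toReal_smul₀ hbm (by simp), ← sub_eq_zero]
    simp only [ENNReal.toReal_ofReal', smul_eq_mul]
    rw [← integral_sub (I1 t ht) (I2 t ht)]
    refine Eq.trans ?_ (hFt t ht).2
    congr 1; funext x
    rw [← sub_mul]
    congr 1
    rcases le_total 0 (F x) with h | h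
    · rw [max_eq_left h, max_eq_right (by linarith)]; ring
    · rw [max_eq_right h, max_eq_left (by linarith)]; ring

theorem auxK_eq (β x : ℝ) :
    Real.exp x * Kspec β (Real.exp x) = (1 / Real.pi) * auxH β x := by
  unfold Kspec auxH
  have h1 : Real.exp x * Real.exp x ^ (β - 1) = Real.exp (β * x) := by
    rw [← Real.exp_mul, ← Real.exp_add]; congr 1; ring
  have h2 : Real.exp x ^ (2 * β) = Real.exp (β*x) ^ 2 := by
    rw [← Real.exp_mul, ← Real.exp_nat_mul]; congr 1; push_cast; ring
  have h3 : Real.exp x ^ β = Real.exp (β*x) := by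
    rw [← Real.exp_mul]; congr 1; ring
  rw [h2, h3, ← h1]
  ring

theorem auxH_nonneg (β x : ℝ) (hβ : β ∈ Set.Ioo (0:ℝ) 1) : 0 ≤ auxH β x := by
  have hpi := Real.pi_pos
  have : 0 < Real.sin (β * Real.pi) :=
    Real.sin_pos_of_pos_of_lt_pi (by have := hβ.1; positivity) (by nlinarith [hβ.2])
  have := auxden_pos β (Real.exp (β*x)) hβ
  unfold auxH
  positivity

theorem auxK_nonneg (β θ : ℝ) (hβ : β ∈ Set.Ioo (0:ℝ) 1) (h : 0 < θ) : 0 ≤ θ * Kspec β θ := by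
  rw [← Real.exp_log h, auxK_eq]
  have := auxH_nonneg β (Real.log θ) hβ
  have hpi := Real.pi_pos
  positivity

theorem auxK_meas (β : ℝ) : Measurable (fun θ => θ * Kspec β θ) := by
  unfold Kspec
  fun_prop

theorem aux_stieltjes (β s : ℝ) (hβ : β ∈ Set.Ioo (0:ℝ) 1) (hs : 0 < s) :
    ∫⁻ θ in Ioi (0:ℝ), ENNReal.ofReal (θ * Kspec β θ / (θ + s)) =
      ENNReal.ofReal (1 / (1 + s ^ β)) := by
  have hpi := Real.pi_pos
  set a := Real.log s with ha
  have hsa : Real.exp a = s := Real.exp_log hs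
  set Q : ℝ → ℝ := fun x => auxH β x * (Real.exp x / (Real.exp x + Real.exp a)) with hQ
  have hlim := aux_claimA β a hβ
  have hHc : Continuous (auxH β) := by
    unfold auxH
    refine Continuous.div (by fun_prop) (by fun_prop) (fun x => (auxden_pos β _ hβ).ne')
  have hQc : Continuous Q := hHc.mul
    (Continuous.div (by fun_prop) (by fun_prop) (fun x => by positivity))
  have hQ0 : ∀ x, 0 ≤ Q x := fun x => mul_nonneg (auxH_nonneg β x hβ) (by positivity)
  have hQi : Integrable Q := by
    refine integrable_of_intervalIntegral_norm_tendsto (Real.pi / (1 + Real.exp (β * a)))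
      (a := fun R : ℝ => -R) (b := fun R => R) (l := atTop) (fun R => ?_) tendsto_neg_atTop_atBot
      tendsto_id ?_
    · exact hQc.integrableOn_Ioc
    · refine hlim.congr (fun R => ?_)
      congr 1; funext x
      exact (Real.norm_of_nonneg (hQ0 x)).symm
  have hQv : ∫ x, Q x = Real.pi / (1 + Real.exp (β * a)) :=
    tendsto_nhds_unique (intervalIntegral_tendsto_integral hQi tendsto_neg_atTop_atBot tendsto_id) hlim
  have him : Ioi (0:ℝ) = Real.exp '' univ := by rw [image_univ, Real.range_exp]
  have hfe : (fun x => |Real.exp x| • (Real.exp x * Kspec β (Real.exp x) / (Real.exp x + s))) =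
      fun x => (1 / Real.pi) * Q x := by
    funext x
    rw [auxK_eq, abs_of_pos (Real.exp_pos x), smul_eq_mul, hQ]; simp only
    rw [hsa]; ring
  have hI : IntegrableOn (fun θ => θ * Kspec β θ / (θ + s)) (Ioi 0) := by
    rw [him, integrableOn_image_iff_integrableOn_abs_deriv_smul MeasurableSet.univ
      (fun x _ => (Real.hasDerivAt_exp x).hasDerivWithinAt) Real.exp_injective.injOn]
    rw [hfe, integrableOn_univ]
    exact hQi.const_mul _
  have hv : ∫ θ in Ioi (0:ℝ), θ * Kspec β θ / (θ + s) = 1 / (1 + s ^ β) := by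
    rw [him, integral_image_eq_integral_abs_deriv_smul MeasurableSet.univ
      (fun x _ => (Real.hasDerivAt_exp x).hasDerivWithinAt) Real.exp_injective.injOn]
    rw [hfe, setIntegral_univ, integral_const_mul, hQv, ← hsa, ← Real.exp_mul, mul_comm a]
    field_simp
  rw [← hv, ofReal_integral_eq_lintegral_ofReal hI]
  filter_upwards [ae_restrict_mem measurableSet_Ioi] with θ hθ
  have hθ : 0 < θ := hθ
  exact div_nonneg (auxK_nonneg β θ hβ hθ) (by positivity)

noncomputable def auxg (β t : ℝ) : ENNReal :=
  ∫⁻ θ in Ioi (0:ℝ), ENNReal.ofReal (Real.exp (-(t*θ))) * ENNReal.ofReal (θ * Kspec β θ)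

theorem auxg_meas (β : ℝ) : Measurable (auxg β) := by
  unfold auxg
  apply Measurable.lintegral_prod_right'
    (f := fun p : ℝ × ℝ => ENNReal.ofReal (Real.exp (-(p.1*p.2))) * ENNReal.ofReal (p.2 * Kspec β p.2))
  have : Measurable (fun p : ℝ × ℝ => p.2 * Kspec β p.2) := (auxK_meas β).comp measurable_snd
  exact Measurable.mul (by fun_prop) this.ennreal_ofReal

theorem aux_exp_lint (r : ℝ) (hr : 0 < r) :
    ∫⁻ t in Ioi (0:ℝ), ENNReal.ofReal (Real.exp (-(r*t))) = ENNReal.ofReal (1 / r) := by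
  have h1 := integrableOn_exp_mul_Ioi (by linarith : -r < 0) 0
  have h2 := integral_exp_mul_Ioi (by linarith : -r < 0) 0
  simp only [neg_mul] at h1 h2
  rw [← ofReal_integral_eq_lintegral_ofReal h1, h2]
  · simp
  · exact Eventually.of_forall fun x => (Real.exp_pos _).le

theorem auxLv (β s v : ℝ) (hs : 0 < s) :
    ∫⁻ τ in Ioi (0:ℝ), auxg β (τ + v) * ENNReal.ofReal (Real.exp (-(s*τ))) =
    ∫⁻ θ in Ioi (0:ℝ), ENNReal.ofReal (Real.exp (-(θ*v))) *
      ENNReal.ofReal (θ * Kspec β θ / (θ + s)) := by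
  have hK := auxK_meas β
  have hKs : Measurable (fun p : ℝ × ℝ => p.2 * Kspec β p.2) := (auxK_meas β).comp measurable_snd
  unfold auxg
  simp_rw [← lintegral_mul_const' _ _ ENNReal.ofReal_ne_top]
  rw [lintegral_lintegral_swap]
  · refine setLIntegral_congr_fun measurableSet_Ioi (fun θ hθ => ?_)
    have hθ : 0 < θ := hθ
    have e : ∀ τ, ENNReal.ofReal (Real.exp (-((τ+v)*θ))) * ENNReal.ofReal (θ * Kspec β θ) *
        ENNReal.ofReal (Real.exp (-(s*τ))) = ENNReal.ofReal (Real.exp (-(θ*v))) *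
        ENNReal.ofReal (θ * Kspec β θ) * ENNReal.ofReal (Real.exp (-((θ+s)*τ))) := by
      intro τ
      rw [mul_right_comm, mul_right_comm (ENNReal.ofReal (Real.exp (-(θ*v)))),
        ← ENNReal.ofReal_mul (Real.exp_pos _).le, ← ENNReal.ofReal_mul (Real.exp_pos _).le,
        ← Real.exp_add, ← Real.exp_add]
      congr 3; ring
    simp only [e]
    rw [lintegral_const_mul' _ _ (ENNReal.mul_ne_top ENNReal.ofReal_ne_top ENNReal.ofReal_ne_top),
      aux_exp_lint _ (by positivity), mul_assoc, ← ENNReal.ofReal_mul' (by positivity), mul_one_div]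
  · apply Measurable.aemeasurable
    refine Measurable.mul (Measurable.mul ?_ hKs.ennreal_ofReal) ?_ <;> fun_prop

theorem auxg_laplace (β s : ℝ) (hβ : β ∈ Set.Ioo (0:ℝ) 1) (hs : 0 < s) :
    ∫⁻ τ in Ioi (0:ℝ), auxg β τ * ENNReal.ofReal (Real.exp (-(s*τ))) =
      ENNReal.ofReal (1 / (1 + s ^ β)) := by
  have := auxLv β s 0 hs
  simpa [aux_stieltjes β s hβ hs] using this

theorem auxg_fin (β : ℝ) (hβ : β ∈ Set.Ioo (0:ℝ) 1) :
    ∀ᵐ t ∂(volume.restrict (Ioi (0:ℝ))), auxg β t < ⊤ := by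
  have h := auxg_laplace β 1 hβ one_pos
  have hm := auxg_meas β
  have := ae_lt_top (μ := volume.restrict (Ioi (0:ℝ)))
    (f := fun τ => auxg β τ * ENNReal.ofReal (Real.exp (-(1*τ))))
    (hm.mul (by fun_prop)) (by rw [h]; exact ENNReal.ofReal_ne_top)
  filter_upwards [this] with t ht
  refine ENNReal.lt_top_of_mul_ne_top_left ht.ne ?_
  simp [Real.exp_pos]

theorem auxf_eq (β : ℝ) (hβ : β ∈ Set.Ioo (0:ℝ) 1) :
    ∀ᵐ t ∂(volume.restrict (Ioi (0:ℝ))), fML β t = (auxg β t).toReal ∧ auxg β t < ⊤ := by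
  have hfin := auxg_fin β hβ
  have hm := auxg_meas β
  have key : ∀ s : ℝ, 1 < s →
      IntegrableOn (fun t => (auxg β t).toReal * Real.exp (-(s*t))) (Ioi 0) ∧
      ∫ t in Ioi (0:ℝ), (auxg β t).toReal * Real.exp (-(s*t)) = 1 / (1 + s^β) := by
    intro s hs
    have hs0 : 0 < s := by linarith
    have e : (fun t => (auxg β t).toReal * Real.exp (-(s*t))) =
        fun t => (auxg β t * ENNReal.ofReal (Real.exp (-(s*t)))).toReal := by
      funext t
      rw [ENNReal.toReal_mul, ENNReal.toReal_ofReal (Real.exp_pos _).le]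
    have hL := auxg_laplace β s hβ hs0
    have hmm : AEMeasurable (fun t => auxg β t * ENNReal.ofReal (Real.exp (-(s*t))))
      (volume.restrict (Ioi (0:ℝ))) := (hm.mul (by fun_prop)).aemeasurable
    rw [e]
    refine ⟨integrable_toReal_of_lintegral_ne_top hmm (by rw [hL]; exact ENNReal.ofReal_ne_top), ?_⟩
    rw [integral_toReal hmm, hL, ENNReal.toReal_ofReal (by positivity)]
    filter_upwards [hfin] with t ht
    exact ENNReal.mul_lt_top ht ENNReal.ofReal_lt_top
  have hD := aux_laplace_inj (fun t => fML β t - (auxg β t).toReal) ?_ ?_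
  · filter_upwards [hD, hfin] with t h1 h2
    exact ⟨by linarith, h2⟩
  · intro s hs
    simp only [sub_mul]
    exact (aux_laplace_f β hβ s hs).1.sub (key s hs).1
  · intro s hs
    simp only [sub_mul]
    rw [integral_sub (aux_laplace_f β hβ s hs).1 (key s hs).1, (key s hs).2,
      (aux_laplace_f β hβ s hs).2, sub_self]

/-- Laplace transform of `τ ↦ ∫_0^∞ f_β(τ+v) μ(v) dv` for a nonnegative measurable `μ`
with finite Laplace transform: it equals `∫_0^∞ h(θ)/(θ+s) μ̃(θ) dθ` where
`h(θ) = θ K_β(θ)`, provided the latter integral is finite. -/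
theorem laplace_shifted_kernel (β : ℝ) (hβ : β ∈ Set.Ioo (0:ℝ) 1) (μ : ℝ → ℝ)
    (hμnn : ∀ v : ℝ, 0 < v → 0 ≤ μ v) (hμmeas : Measurable μ)
    (hμlt : ∀ θ : ℝ, 0 < θ →
      MeasureTheory.IntegrableOn (fun v : ℝ => Real.exp (-(θ * v)) * μ v) (Set.Ioi 0))
    (s : ℝ) (hs : 0 < s)
    (hfin : MeasureTheory.IntegrableOn
      (fun θ : ℝ => (θ * Kspec β θ) / (θ + s) *
        ∫ v in Set.Ioi (0:ℝ), Real.exp (-(θ * v)) * μ v) (Set.Ioi 0)) :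
    ∫ τ in Set.Ioi (0:ℝ),
        (∫ v in Set.Ioi (0:ℝ), fML β (τ + v) * μ v) * Real.exp (-(s * τ)) =
      ∫ θ in Set.Ioi (0:ℝ), (θ * Kspec β θ) / (θ + s) *
        ∫ v in Set.Ioi (0:ℝ), Real.exp (-(θ * v)) * μ v := by
  have hg := auxg_meas β
  have hK := auxK_meas β
  set m : ℝ → ℝ := fun θ => ∫ v in Set.Ioi (0:ℝ), Real.exp (-(θ * v)) * μ v with hm
  have hm0 : ∀ θ, 0 ≤ m θ := fun θ =>
    setIntegral_nonneg measurableSet_Ioi (fun v hv => mul_nonneg (Real.exp_pos _).le (hμnn v hv))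
  set Φ : ℝ → ENNReal := fun τ => ∫⁻ v in Ioi (0:ℝ), auxg β (τ + v) * ENNReal.ofReal (μ v) with hΦ
  have hΦm : Measurable Φ := by
    apply Measurable.lintegral_prod_right'
      (f := fun p : ℝ × ℝ => auxg β (p.1 + p.2) * ENNReal.ofReal (μ p.2))
    exact (hg.comp (by fun_prop)).mul (hμmeas.comp measurable_snd).ennreal_ofReal
  have step1 : ∀ τ ∈ Ioi (0:ℝ), ∫ v in Ioi (0:ℝ), fML β (τ + v) * μ v = (Φ τ).toReal := by
    intro τ hτ
    have hτ : 0 < τ := hτ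
    have hae := auxf_eq β hβ
    rw [ae_restrict_iff' measurableSet_Ioi] at hae
    have hae2 := (measurePreserving_add_left volume τ).quasiMeasurePreserving.ae hae
    have hae3 : ∀ᵐ v ∂(volume.restrict (Ioi (0:ℝ))),
        fML β (τ + v) = (auxg β (τ + v)).toReal ∧ auxg β (τ + v) < ⊤ := by
      rw [ae_restrict_iff' measurableSet_Ioi]
      filter_upwards [hae2] with v hv hv0
      have hv0 : 0 < v := hv0
      exact hv (by simp only [mem_Ioi]; positivity)
    have : ∫ v in Ioi (0:ℝ), fML β (τ + v) * μ v =
        ∫ v in Ioi (0:ℝ), (auxg β (τ + v) * ENNReal.ofReal (μ v)).toReal := by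
      apply integral_congr_ae
      filter_upwards [hae3, ae_restrict_mem measurableSet_Ioi] with v hv hv0
      rw [ENNReal.toReal_mul, ENNReal.toReal_ofReal (hμnn v hv0), hv.1]
    rw [this, integral_toReal]
    · exact ((hg.comp (by fun_prop)).mul hμmeas.ennreal_ofReal).aemeasurable
    · filter_upwards [hae3] with v hv
      exact ENNReal.mul_lt_top hv.2 ENNReal.ofReal_lt_top
  have step3 : ∫⁻ τ in Ioi (0:ℝ), Φ τ * ENNReal.ofReal (Real.exp (-(s * τ))) =
      ENNReal.ofReal (∫ θ in Ioi (0:ℝ), (θ * Kspec β θ) / (θ + s) * m θ) := by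
    rw [ofReal_integral_eq_lintegral_ofReal hfin]
    · simp only [hΦ]
      simp_rw [← lintegral_mul_const' _ _ ENNReal.ofReal_ne_top]
      rw [lintegral_lintegral_swap]
      · have e1 : ∀ v, ∫⁻ τ in Ioi (0:ℝ), auxg β (τ + v) * ENNReal.ofReal (μ v) *
            ENNReal.ofReal (Real.exp (-(s * τ))) =
            ∫⁻ θ in Ioi (0:ℝ), ENNReal.ofReal (μ v) * (ENNReal.ofReal (Real.exp (-(θ*v))) *
              ENNReal.ofReal (θ * Kspec β θ / (θ + s))) := by
          intro v
          rw [lintegral_const_mul' _ _ ENNReal.ofReal_ne_top, ← auxLv β s v hs,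
            ← lintegral_const_mul' _ _ ENNReal.ofReal_ne_top]
          congr 1; funext τ
          ring
        simp_rw [e1]
        rw [lintegral_lintegral_swap]
        · refine setLIntegral_congr_fun measurableSet_Ioi (fun θ hθ => ?_)
          have hθ : 0 < θ := hθ
          have hk : 0 ≤ θ * Kspec β θ / (θ + s) :=
            div_nonneg (auxK_nonneg β θ hβ hθ) (by positivity)
          rw [ENNReal.ofReal_mul hk]
          rw [ofReal_integral_eq_lintegral_ofReal (hμlt θ hθ),
            ← lintegral_const_mul' _ _ ENNReal.ofReal_ne_top]
          · congr 1; funext v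
            rw [ENNReal.ofReal_mul (Real.exp_pos _).le]
            ring
          · filter_upwards [ae_restrict_mem measurableSet_Ioi] with v hv
            exact mul_nonneg (Real.exp_pos _).le (hμnn v hv)
        · apply Measurable.aemeasurable
          have h2 : Measurable (fun p : ℝ × ℝ => p.2 * Kspec β p.2) := hK.comp measurable_snd
          have h3 : Measurable (fun p : ℝ × ℝ => p.2 * Kspec β p.2 / (p.2 + s)) :=
            h2.div (by fun_prop)
          exact (hμmeas.comp measurable_fst).ennreal_ofReal.mul
            (Measurable.mul (by fun_prop) h3.ennreal_ofReal)
      · apply Measurable.aemeasurable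
        refine Measurable.mul ((hg.comp (by fun_prop)).mul
          (hμmeas.comp measurable_snd).ennreal_ofReal) (by fun_prop)
    · filter_upwards [ae_restrict_mem measurableSet_Ioi] with θ hθ
      have hθ : 0 < θ := hθ
      exact mul_nonneg (div_nonneg (auxK_nonneg β θ hβ hθ) (by positivity)) (hm0 θ)
  have hR0 : 0 ≤ ∫ θ in Ioi (0:ℝ), (θ * Kspec β θ) / (θ + s) * m θ := by
    refine setIntegral_nonneg measurableSet_Ioi (fun θ hθ => ?_)
    have hθ : 0 < θ := hθ
    exact mul_nonneg (div_nonneg (auxK_nonneg β θ hβ hθ) (by positivity)) (hm0 θ)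
  have hmeas : Measurable (fun τ => Φ τ * ENNReal.ofReal (Real.exp (-(s * τ)))) :=
    hΦm.mul (by fun_prop)
  have step2 : ∫ τ in Ioi (0:ℝ), (∫ v in Ioi (0:ℝ), fML β (τ + v) * μ v) * Real.exp (-(s * τ)) =
      ∫ τ in Ioi (0:ℝ), (Φ τ * ENNReal.ofReal (Real.exp (-(s * τ)))).toReal := by
    refine setIntegral_congr_fun measurableSet_Ioi (fun τ hτ => ?_)
    rw [step1 τ hτ, ENNReal.toReal_mul, ENNReal.toReal_ofReal (Real.exp_pos _).le]
  rw [step2, integral_toReal hmeas.aemeasurable, step3, ENNReal.toReal_ofReal hR0]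
  exact ae_lt_top hmeas (by rw [step3]; exact ENNReal.ofReal_ne_top)
end

section
/- Let β ∈ (0,1], λ > 0, and α ∈ (0,1). Suppose Λ : [0,∞) → ℝ is nonnegative, measurable, satisfies the renewal equation Λ(t) = λ + α ∫_0^t f_β(t-u) Λ(u) du for all t > 0, and has finite Laplace transform Λ̃(s) = ∫_0^∞ e^{-st} Λ(t) dt for every s > 0. Then for every s > 0, Λ̃(s) = (λ/s) · (1 + s^β) / ((1-α) + s^β), where f_β(t) = t^{β-1} E_{β,β}(-t^β). -/
open MeasureTheory Set Filter

lemma fML_laplace (β s : ℝ) (hβ : 0 < β) (hs : 1 < s) :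
    ∫ t in Set.Ioi (0:ℝ), Real.exp (-(s * t)) * fML β t = 1 / (1 + s ^ β) := by
  have hs0 : 0 < s := by linarith
  have hsβ : 1 < s ^ β := Real.one_lt_rpow hs hβ
  have hpos : ∀ n : ℕ, 0 < (n : ℝ) * β + β := fun n => by positivity
  let G : ℕ → ℝ → ℝ := fun n t =>
    (t ^ ((n : ℝ) * β + β - 1) * Real.exp (-(s * t))) * (Real.Gamma (n * β + β))⁻¹
  let F : ℕ → ℝ → ℝ := fun n t => (-1) ^ n * G n t
  have hG : ∀ n, ∫ t in Set.Ioi (0:ℝ), G n t = (s ^ β)⁻¹ * ((s ^ β)⁻¹) ^ n := by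
    intro n
    have hg : Real.Gamma (n * β + β) ≠ 0 := (Real.Gamma_pos_of_pos (hpos n)).ne'
    simp only [G]
    rw [integral_mul_const, Real.integral_rpow_mul_exp_neg_mul_Ioi (hpos n) hs0,
      mul_assoc, mul_inv_cancel₀ hg, mul_one, one_div, Real.inv_rpow hs0.le,
      Real.rpow_add hs0, mul_comm (n : ℝ) β, Real.rpow_mul hs0.le, Real.rpow_natCast,
      mul_inv, inv_pow, mul_comm]
  have hGi : ∀ n, IntegrableOn (G n) (Set.Ioi 0) := by
    intro n
    refine Integrable.of_integral_ne_zero ?_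
    rw [hG]
    positivity
  have hFi : ∀ n, IntegrableOn (F n) (Set.Ioi 0) := fun n => (hGi n).const_mul _
  have hr : (s ^ β)⁻¹ < 1 := inv_lt_one_of_one_lt₀ hsβ
  have hr0 : 0 < (s ^ β)⁻¹ := by positivity
  have hnorm : ∀ n, ∫ t in Set.Ioi (0:ℝ), ‖F n t‖ = (s ^ β)⁻¹ * ((s ^ β)⁻¹) ^ n := by
    intro n
    rw [← hG n]
    refine setIntegral_congr_fun measurableSet_Ioi fun t ht => ?_
    have ht' : (0:ℝ) < t := ht
    have : 0 ≤ G n t := by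
      have := Real.Gamma_pos_of_pos (hpos n)
      simp only [G]; positivity
    simp [F, abs_of_nonneg this]
  have hsum := hasSum_integral_of_summable_integral_norm hFi (by
    simp_rw [hnorm]
    exact (summable_geometric_of_lt_one hr0.le hr).mul_left _)
  have hF : ∀ n, ∫ t in Set.Ioi (0:ℝ), F n t = (s ^ β)⁻¹ * (-(s ^ β)⁻¹) ^ n := by
    intro n
    simp only [F]
    rw [integral_const_mul, hG, neg_pow ((s ^ β)⁻¹)]
    ring
  simp_rw [hF] at hsum
  have h2 := (hasSum_geometric_of_abs_lt_one (r := -(s ^ β)⁻¹)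
    (by rw [abs_neg, abs_of_pos hr0]; exact hr)).mul_left ((s ^ β)⁻¹)
  have h3 := hsum.unique h2
  have h4 : ∫ t in Set.Ioi (0:ℝ), Real.exp (-(s * t)) * fML β t
      = ∫ t in Set.Ioi (0:ℝ), ∑' n, F n t := by
    refine setIntegral_congr_fun measurableSet_Ioi fun t ht => ?_
    have ht' : (0:ℝ) < t := ht
    simp only [fML, ML2]
    rw [← mul_assoc, ← tsum_mul_left]
    refine tsum_congr fun n => ?_
    simp only [F, G]
    rw [neg_pow (t ^ β), ← Real.rpow_natCast (t ^ β), ← Real.rpow_mul ht'.le,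
      show (n : ℝ) * β + β - 1 = β * n + (β - 1) by ring, Real.rpow_add ht', div_eq_mul_inv]
    ring
  rw [h4, h3]
  have : s ^ β ≠ 0 := by positivity
  have : 1 + s ^ β ≠ 0 := by positivity
  have h5 : 1 - -(s ^ β)⁻¹ = (1 + s ^ β) * (s ^ β)⁻¹ := by field_simp; ring
  rw [h5]
  field_simp

lemma laplace_large (β lam α : ℝ) (hβ : β ∈ Set.Ioc (0:ℝ) 1)
    (hα : α ∈ Set.Ioo (0:ℝ) 1) (Λ : ℝ → ℝ)
    (hrenewal : ∀ t : ℝ, 0 < t → Λ t = lam + α * ∫ u in (0:ℝ)..t, fML β (t - u) * Λ u)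
    (hLT : ∀ s : ℝ, 0 < s →
      MeasureTheory.IntegrableOn (fun t : ℝ => Real.exp (-(s * t)) * Λ t) (Set.Ioi 0))
    (s : ℝ) (hs : 1 < s) :
    ∫ t in Set.Ioi (0:ℝ), Real.exp (-(s * t)) * Λ t =
      (lam / s) * (1 + s ^ β) / ((1 - α) + s ^ β) := by
  have hs0 : 0 < s := by linarith
  have hsβ : 0 < s ^ β := by positivity
  have hf := fML_laplace β s hβ.1 hs
  have hfi : IntegrableOn (fun t => Real.exp (-(s * t)) * fML β t) (Set.Ioi 0) := by
    refine Integrable.of_integral_ne_zero ?_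
    rw [hf]; positivity
  have hei : IntegrableOn (fun t : ℝ => lam * Real.exp (-(s * t))) (Set.Ioi 0) := by
    have := (integrableOn_exp_mul_Ioi (neg_neg_of_pos hs0) 0).const_mul lam
    simp only [neg_mul] at this
    exact this
  have he : ∫ t in Set.Ioi (0:ℝ), lam * Real.exp (-(s * t)) = lam / s := by
    have := integral_exp_mul_Ioi (neg_neg_of_pos hs0) 0
    simp only [neg_mul] at this
    rw [integral_const_mul, this]
    simp [div_eq_mul_inv]
  have hc := integral_posConvolution (hLT s hs0) hfi (ContinuousLinearMap.mul ℝ ℝ)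
  simp only [ContinuousLinearMap.mul_apply'] at hc
  have hsub := integral_sub (hLT s hs0) hei
  have hcongr : ∫ t in Set.Ioi (0:ℝ), (Real.exp (-(s * t)) * Λ t - lam * Real.exp (-(s * t)))
      = ∫ t in Set.Ioi (0:ℝ), α * ∫ u in (0:ℝ)..t, (Real.exp (-(s * u)) * Λ u) *
          (Real.exp (-(s * (t - u))) * fML β (t - u)) := by
    refine setIntegral_congr_fun measurableSet_Ioi fun t ht => ?_
    have : ∫ u in (0:ℝ)..t, (Real.exp (-(s * u)) * Λ u) *
          (Real.exp (-(s * (t - u))) * fML β (t - u))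
        = Real.exp (-(s * t)) * ∫ u in (0:ℝ)..t, fML β (t - u) * Λ u := by
      rw [← intervalIntegral.integral_const_mul]
      refine intervalIntegral.integral_congr fun u _ => ?_
      have : Real.exp (-(s * t)) = Real.exp (-(s * u)) * Real.exp (-(s * (t - u))) := by
        rw [← Real.exp_add]; congr 1; ring
      simp only [this]
      ring
    rw [this, hrenewal t ht]
    ring
  rw [hcongr, integral_const_mul, hc, he, hf] at hsub
  have h1 : 1 + s ^ β ≠ 0 := by positivity
  have h2 : (1 - α) + s ^ β ≠ 0 := by have := hα.2; intro h; linarith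
  rw [eq_div_iff h2]
  field_simp at hsub ⊢
  linarith

/-- If `Λ` is nonnegative, measurable, solves the renewal equation
`Λ(t) = λ + α ∫_0^t f_β(t-u) Λ(u) du` and has finite Laplace transform for every `s > 0`,
then its Laplace transform is `(λ/s)(1+s^β)/((1-α)+s^β)`. -/
theorem laplace_intensity_expectation (β lam α : ℝ) (hβ : β ∈ Set.Ioc (0:ℝ) 1)
    (hlam : 0 < lam) (hα : α ∈ Set.Ioo (0:ℝ) 1) (Λ : ℝ → ℝ)
    (hΛnn : ∀ t : ℝ, 0 ≤ t → 0 ≤ Λ t) (hΛmeas : Measurable Λ)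
    (hrenewal : ∀ t : ℝ, 0 < t → Λ t = lam + α * ∫ u in (0:ℝ)..t, fML β (t - u) * Λ u)
    (hLT : ∀ s : ℝ, 0 < s →
      MeasureTheory.IntegrableOn (fun t : ℝ => Real.exp (-(s * t)) * Λ t) (Set.Ioi 0))
    (s : ℝ) (hs : 0 < s) :
    ∫ t in Set.Ioi (0:ℝ), Real.exp (-(s * t)) * Λ t =
      (lam / s) * (1 + s ^ β) / ((1 - α) + s ^ β) := by
  let ν : Measure ℝ := (volume.restrict (Set.Ioi 0)).withDensity
    (fun t => ((Λ t).toNNReal : ENNReal))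
  have hm : Measurable fun t => (Λ t).toNNReal := hΛmeas.real_toNNReal
  have hpt : ∀ x : ℝ, Set.EqOn (fun t => Real.exp (-(x * t)) * Λ t)
      (fun t => (Λ t).toNNReal • Real.exp (-x * t)) (Set.Ioi 0) := by
    intro x t ht
    have := hΛnn t (le_of_lt ht)
    simp [NNReal.smul_def, Real.coe_toNNReal _ this, mul_comm]
  have hsub : ∀ x : ℝ, 0 < x → -x ∈ ProbabilityTheory.integrableExpSet id ν := by
    intro x hx
    show Integrable (fun t => Real.exp (-x * id t)) ν
    rw [integrable_withDensity_iff_integrable_smul hm]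
    exact (integrableOn_congr_fun (hpt x) measurableSet_Ioi).1 (hLT x hx)
  have hmgf : ∀ x : ℝ, ProbabilityTheory.mgf id ν (-x)
      = ∫ t in Set.Ioi (0:ℝ), Real.exp (-(x * t)) * Λ t := by
    intro x
    rw [setIntegral_congr_fun measurableSet_Ioi (hpt x)]
    show ∫ t, Real.exp (-x * id t) ∂ν = _
    rw [integral_withDensity_eq_integral_smul hm]
    rfl
  have hint : ∀ x : ℝ, 0 < x → -x ∈ interior (ProbabilityTheory.integrableExpSet id ν) := by
    intro x hx
    refine (interior_maximal ?_ isOpen_Iio) (show -x ∈ Set.Iio (0:ℝ) by simpa using hx)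
    intro y hy
    have := hsub (-y) (by simpa using hy)
    simpa using this
  have hA : AnalyticOnNhd ℝ (fun x => ProbabilityTheory.mgf id ν (-x)) (Set.Ioi 0) := by
    intro x hx
    exact (ProbabilityTheory.analyticAt_mgf (hint x hx)).fun_comp (analyticAt_id.neg)
  have hB : AnalyticOnNhd ℝ (fun x : ℝ => (lam / x) * (1 + Real.exp (Real.log x * β)) /
      ((1 - α) + Real.exp (Real.log x * β))) (Set.Ioi 0) := by
    intro x hx
    have hx' : (0:ℝ) < x := hx
    have hE : AnalyticAt ℝ (fun x : ℝ => Real.exp (Real.log x * β)) x :=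
      ((analyticAt_id.log hx').mul analyticAt_const).rexp
    refine AnalyticAt.div ?_ (analyticAt_const.add hE) ?_
    · exact (analyticAt_const.div analyticAt_id hx'.ne').mul (analyticAt_const.add hE)
    · have := hα.2
      have := Real.exp_pos (Real.log x * β)
      intro h; linarith
  have key := hA.eqOn_of_preconnected_of_eventuallyEq hB isPreconnected_Ioi
    (z₀ := 2) (by norm_num) (by
      filter_upwards [Ioi_mem_nhds (show (1:ℝ) < 2 by norm_num)] with x hx
      have hx' : (1:ℝ) < x := hx
      rw [hmgf, laplace_large β lam α hβ hα Λ hrenewal hLT x hx',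
        Real.rpow_def_of_pos (by linarith)])
  have := key (show s ∈ Set.Ioi (0:ℝ) from hs)
  simp only [hmgf] at this
  rw [this, Real.rpow_def_of_pos hs]
end
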